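/- arXiv:1211.3299 — 2 statements merged into one kernel-verified Lean document; each statement's English description precedes it below -/
import Mathlib

section
/- Consider the complete bipartite graph K_{n,n} with m = n² edges whose edge weights w_{ij} ∈ [0,1] are independent random variables, each having a probability density function bounded from above by φ, and let τ be the number of iterations until the belief propagation algorithm of Bayati et al. for maximum-weight bipartite matching converges. Then there is an absolute constant C > 0 such that for every t ≥ 1, the probability that τ ≥ t is at most C·n·m·φ/t. -/
open MeasureTheory

/-- The messages of the belief propagation algorithm of Bayati et al. on the complete
bipartite graph `K_{n,n}` with weights `w`. `(BPmsg n w t).1 i j r` is the message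
`m⃗ᵗ_{ij}(r)` from `u_i` to `v_j` and `(BPmsg n w t).2 j i r` is the message
`m⃖ᵗ_{ji}(r)` from `v_j` to `u_i` at iteration `t`. (For `n ≤ 1` the maxima over the
empty index set take the junk value `0` of real suprema.) -/
noncomputable def BPmsg (n : ℕ) (w : Fin n → Fin n → ℝ) :
    ℕ → (Fin n → Fin n → Fin n → ℝ) × (Fin n → Fin n → Fin n → ℝ)
  | 0 =>
    (fun i j r => if r = i then w i j else 0,
     fun j i r => if r = j then w i j else 0)
  | t + 1 =>
    (fun i j r =>
      if r = i then w i j + ∑ k ∈ Finset.univ.filter (· ≠ j), (BPmsg n w t).2 k i j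
      else ⨆ q : {q : Fin n // q ≠ j},
        (w i q + ∑ k ∈ Finset.univ.filter (· ≠ j), (BPmsg n w t).2 k i (q : Fin n)),
     fun j i r =>
      if r = j then w i j + ∑ k ∈ Finset.univ.filter (· ≠ i), (BPmsg n w t).1 k j i
      else ⨆ q : {q : Fin n // q ≠ i},
        (w q j + ∑ k ∈ Finset.univ.filter (· ≠ i), (BPmsg n w t).1 k j (q : Fin n)))

/-- The belief `bᵗ_{u_i}(r)` of node `u_i` at iteration `t`. -/
noncomputable def belief (n : ℕ) (w : Fin n → Fin n → ℝ) (t : ℕ) (i r : Fin n) : ℝ :=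
  w i r + ∑ k, (BPmsg n w t).2 k i r

/-- A matching of `K_{n,n}`, given as a set of edges `(i, j)` (meaning `(u_i, v_j)`)
that are pairwise non-adjacent. -/
def IsMatching (n : ℕ) (M : Finset (Fin n × Fin n)) : Prop :=
  ∀ p ∈ M, ∀ q ∈ M, p ≠ q → p.1 ≠ q.1 ∧ p.2 ≠ q.2

/-- The weight of a matching of `K_{n,n}`. -/
noncomputable def matchingWeight (n : ℕ) (w : Fin n → Fin n → ℝ)
    (M : Finset (Fin n × Fin n)) : ℝ :=
  ∑ p ∈ M, w p.1 p.2

/-- Belief propagation has converged by iteration `t`: there is a unique maximum-weight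
matching `M`, and at every iteration `s ≥ t` the estimated matching (matching each `u_i`
to the unique maximizer of its belief) equals `M`. -/
def BPConvergedBy (n : ℕ) (w : Fin n → Fin n → ℝ) (t : ℕ) : Prop :=
  ∃ M : Finset (Fin n × Fin n), IsMatching n M ∧
    (∀ M', IsMatching n M' → M' ≠ M → matchingWeight n w M' < matchingWeight n w M) ∧
    ∀ s, t ≤ s → ∀ i : Fin n, ∃ j : Fin n, (i, j) ∈ M ∧
      ∀ r : Fin n, r ≠ j → belief n w s i r < belief n w s i j


lemma closed_walk_nonneg {n : ℕ} (W : Fin n → Fin n → ℝ)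
    (hW : ∀ ρ : Equiv.Perm (Fin n), ∑ a, W a (ρ a) ≤ ∑ a, W a a)
    (f : ℕ → Fin n) (L : ℕ) (hL : 0 < L) (hf : f L = f 0) :
    0 ≤ ∑ l ∈ Finset.range L, (W (f (l+1)) (f (l+1)) - W (f l) (f (l+1))) := by
  classical
  set P : Matrix (Fin n) (Fin n) ℝ := fun a b => (1 / (L:ℝ)) * ∑ l ∈ Finset.range L,
    ((if a = b then 1 else 0) - (if a = f (l+1) then (if b = f (l+1) then 1 else 0) else 0)
      + (if a = f l then (if b = f (l+1) then 1 else 0) else 0)) with hP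
  have hL' : (L:ℝ) ≠ 0 := by positivity
  have hPd : P ∈ doublyStochastic ℝ (Fin n) := by
    rw [mem_doublyStochastic_iff_sum]
    refine ⟨fun i j => ?_, fun i => ?_, fun j => ?_⟩
    · apply mul_nonneg (by positivity)
      apply Finset.sum_nonneg
      intro l _
      split_ifs <;> first | (norm_num; done) | grind
    · simp only [hP]
      rw [← Finset.mul_sum, Finset.sum_comm]
      have : ∀ l, ∑ j, ((if i = j then (1:ℝ) else 0)
          - (if i = f (l+1) then (if j = f (l+1) then 1 else 0) else 0)
          + (if i = f l then (if j = f (l+1) then 1 else 0) else 0))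
          = 1 - ((if i = f (l+1) then 1 else 0) - (if i = f l then 1 else 0)) := by
        intro l
        rw [Finset.sum_add_distrib, Finset.sum_sub_distrib]
        split_ifs <;> simp
      simp only [this]
      rw [Finset.sum_sub_distrib, Finset.sum_range_sub (fun l => if i = f l then (1:ℝ) else 0), hf]
      simp [hL']
    · simp only [hP]
      rw [← Finset.mul_sum, Finset.sum_comm]
      have : ∀ l, ∑ i, ((if i = j then (1:ℝ) else 0)
          - (if i = f (l+1) then (if j = f (l+1) then 1 else 0) else 0)
          + (if i = f l then (if j = f (l+1) then 1 else 0) else 0))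
          = 1 := by
        intro l
        rw [Finset.sum_add_distrib, Finset.sum_sub_distrib]
        simp
      simp only [this]
      simp [hL']
  obtain ⟨c, hc0, hc1, hc⟩ := exists_eq_sum_perm_of_mem_doublyStochastic hPd
  have h1 : ∑ a, ∑ b, P a b * W a b = ∑ ρ, c ρ * ∑ a, W a (ρ a) := by
    rw [← hc]
    simp only [Matrix.sum_apply, Matrix.smul_apply, Finset.sum_mul, smul_eq_mul]
    simp only [Finset.mul_sum]
    rw [Finset.sum_comm' (t' := Finset.univ) (s' := fun _ => Finset.univ) (by simp)]
    simp only [Finset.sum_comm (s := (Finset.univ : Finset (Fin n))) (t := (Finset.univ : Finset (Equiv.Perm (Fin n))))]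
    refine Finset.sum_congr rfl fun ρ _ => ?_
    rw [Finset.sum_comm]
    refine Finset.sum_congr rfl fun a _ => ?_
    simp [Equiv.toPEquiv_apply, PEquiv.toMatrix_apply, eq_comm]
  have h2 : ∑ ρ, c ρ * ∑ a, W a (ρ a) ≤ ∑ a, W a a := by
    calc _ ≤ ∑ ρ, c ρ * ∑ a, W a a :=
          Finset.sum_le_sum fun ρ _ => mul_le_mul_of_nonneg_left (hW ρ) (hc0 ρ)
      _ = _ := by rw [← Finset.sum_mul, hc1, one_mul]
  have h3 : ∑ a, ∑ b, P a b * W a b = (1 / (L:ℝ)) * (∑ l ∈ Finset.range L,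
      (∑ a, W a a - (W (f (l+1)) (f (l+1)) - W (f l) (f (l+1))))) := by
    simp only [hP, mul_assoc, ← Finset.mul_sum, Finset.sum_mul]
    congr 1
    have : ∀ a : Fin n, ∑ b, ∑ l ∈ Finset.range L, (((if a = b then (1:ℝ) else 0)
          - (if a = f (l+1) then (if b = f (l+1) then 1 else 0) else 0)
          + (if a = f l then (if b = f (l+1) then 1 else 0) else 0)) * W a b)
        = ∑ l ∈ Finset.range L, ∑ b, (((if a = b then (1:ℝ) else 0)
          - (if a = f (l+1) then (if b = f (l+1) then 1 else 0) else 0)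
          + (if a = f l then (if b = f (l+1) then 1 else 0) else 0)) * W a b) :=
      fun a => Finset.sum_comm
    simp only [this]
    rw [Finset.sum_comm]
    refine Finset.sum_congr rfl fun l _ => ?_
    simp only [add_mul, sub_mul, Finset.sum_add_distrib, Finset.sum_sub_distrib, ite_mul, one_mul,
      zero_mul]
    have e : ∀ x y : Fin n, ∑ a, ∑ b, (if a = x then (if b = y then W a b else 0) else 0) = W x y := by
      intro x y
      rw [Finset.sum_eq_single x]
      · simp
      · intro a _ ha; simp [ha]
      · simp
    rw [e, e]
    simp
    ring
  rw [h1.symm, h3, Finset.sum_sub_distrib] at h2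
  simp only [Finset.sum_const, Finset.card_range, nsmul_eq_mul, mul_sub] at h2
  rw [← mul_assoc, one_div, inv_mul_cancel₀ hL', one_mul] at h2
  have h4 : 0 ≤ (L:ℝ)⁻¹ * ∑ l ∈ Finset.range L, (W (f (l+1)) (f (l+1)) - W (f l) (f (l+1))) := by
    linarith
  exact nonneg_of_mul_nonneg_right h4 (by positivity)

lemma exists_potential {n : ℕ} (W : Fin n → Fin n → ℝ)
    (hW : ∀ ρ : Equiv.Perm (Fin n), ∑ a, W a (ρ a) ≤ ∑ a, W a a) :
    ∃ π : Fin n → ℝ, ∀ a b, π b - π a ≤ W b b - W a b := by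
  let cost : ℕ × (ℕ → Fin n) → ℝ := fun q => ∑ l ∈ Finset.range q.1,
    (W (q.2 (l+1)) (q.2 (l+1)) - W (q.2 l) (q.2 (l+1)))
  let S : Fin n → Set ℝ := fun b => cost '' {q | q.2 q.1 = b}
  have hne : ∀ b, (S b).Nonempty := fun b => ⟨_, (0, fun _ => b), rfl, rfl⟩
  obtain ⟨B, hB⟩ : ∃ B : ℝ, ∀ a b, W b b - W a b ≤ B := by
    obtain ⟨B, hB⟩ := (Set.finite_range (fun p : Fin n × Fin n => W p.2 p.2 - W p.1 p.2)).bddAbove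
    exact ⟨B, fun a b => hB ⟨(a, b), rfl⟩⟩
  have hbd : ∀ b, BddBelow (S b) := by
    intro b
    refine ⟨-B, ?_⟩
    rintro _ ⟨⟨L, f⟩, hf, rfl⟩
    have h := closed_walk_nonneg W hW (Function.update f (L+1) (f 0)) (L+1) (by omega) (by simp)
    rw [Finset.sum_range_succ] at h
    rw [Finset.sum_congr rfl (g := fun l => W (f (l+1)) (f (l+1)) - W (f l) (f (l+1)))] at h
    · simp only [Function.update_self] at h
      have := hB (Function.update f (L+1) (f 0) L) (f 0)
      change -B ≤ ∑ l ∈ Finset.range L, _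
      linarith
    · intro l hl
      have := Finset.mem_range.1 hl
      rw [Function.update_of_ne (by omega), Function.update_of_ne (by omega)]
  refine ⟨fun b => sInf (S b), fun a b => ?_⟩
  have key : sInf (S b) - (W b b - W a b) ≤ sInf (S a) := by
    apply le_csInf (hne a)
    rintro _ ⟨⟨L, f⟩, hf, rfl⟩
    have hf' : f L = a := hf
    have : sInf (S b) ≤ cost (L+1, Function.update f (L+1) b) :=
      csInf_le (hbd b) ⟨_, by simp, rfl⟩
    have e : cost (L+1, Function.update f (L+1) b) = cost (L, f) + (W b b - W a b) := by
      simp only [cost]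
      rw [Finset.sum_range_succ]
      congr 1
      · refine Finset.sum_congr rfl fun l hl => ?_
        have := Finset.mem_range.1 hl
        rw [Function.update_of_ne (by omega), Function.update_of_ne (by omega)]
      · rw [Function.update_self, Function.update_of_ne (by omega), hf']
    linarith
  simp only
  linarith

/-- Normalised message differences: `(BPdiff n w t).1 i j` from `u_i` to `v_j`,
`(BPdiff n w t).2 j i` from `v_j` to `u_i`. -/
noncomputable def BPdiff (n : ℕ) (w : Fin n → Fin n → ℝ) :
    ℕ → (Fin n → Fin n → ℝ) × (Fin n → Fin n → ℝ)
  | 0 => (fun i j => w i j, fun j i => w i j)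
  | t + 1 =>
    (fun i j => w i j - ⨆ q : {q : Fin n // q ≠ j}, (BPdiff n w t).2 q i,
     fun j i => w i j - ⨆ q : {q : Fin n // q ≠ i}, (BPdiff n w t).1 q j)

lemma sup_aux {ι : Type*} [Finite ι] [Nonempty ι] (S : ℝ) (f : ι → ℝ) :
    (⨆ q, (S + 2 * f q)) = S + 2 * ⨆ q, f q := by
  apply le_antisymm
  · apply ciSup_le
    intro q
    have := le_ciSup (Set.finite_range f).bddAbove q
    linarith
  · have : (⨆ q, f q) ≤ ((⨆ q, (S + 2 * f q)) - S) / 2 := by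
      apply ciSup_le
      intro q
      have := le_ciSup (Set.finite_range (fun q => S + 2 * f q)).bddAbove q
      linarith
    linarith

lemma ne_nonempty {n : ℕ} (hn : 2 ≤ n) (j : Fin n) : Nonempty {q : Fin n // q ≠ j} := by
  have : Nontrivial (Fin n) := Fin.nontrivial_iff_two_le.2 hn
  obtain ⟨q, hq⟩ := exists_ne j
  exact ⟨⟨q, hq⟩⟩

lemma step_aux {n : ℕ} (hn : 2 ≤ n) (j : Fin n) (a b x : Fin n → ℝ) (m : Fin n → Fin n → ℝ)
    (hm : ∀ k q, m k q = b k + if q = k then 2 * x k - a k else 0) :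
    (∑ k ∈ Finset.univ.filter (· ≠ j), m k j = ∑ k ∈ Finset.univ.filter (· ≠ j), b k) ∧
    (⨆ q : {q : Fin n // q ≠ j}, (a q + ∑ k ∈ Finset.univ.filter (· ≠ j), m k (q : Fin n)))
      = ∑ k ∈ Finset.univ.filter (· ≠ j), b k + 2 * ⨆ q : {q : Fin n // q ≠ j}, x q := by
  have := ne_nonempty hn j
  constructor
  · refine Finset.sum_congr rfl fun k hk => ?_
    have : k ≠ j := by simpa using hk
    rw [hm, if_neg this.symm, add_zero]
  · rw [← sup_aux]
    congr 1
    ext ⟨q, hq⟩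
    simp only [hm, Finset.sum_add_distrib]
    rw [Finset.sum_ite_eq, if_pos (by simpa using hq)]
    ring

lemma BPmsg_eq {n : ℕ} (hn : 2 ≤ n) (w : Fin n → Fin n → ℝ) (t : ℕ) :
    ∃ bY bX : Fin n → Fin n → ℝ,
      (∀ i j r, (BPmsg n w t).1 i j r =
        bY i j + if r = i then 2 * (BPdiff n w t).1 i j - w i j else 0) ∧
      (∀ j i r, (BPmsg n w t).2 j i r =
        bX j i + if r = j then 2 * (BPdiff n w t).2 j i - w i j else 0) := by
  induction t with
  | zero =>
    refine ⟨fun _ _ => 0, fun _ _ => 0, ?_, ?_⟩ <;> intros <;> simp only [BPmsg, BPdiff] <;>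
      split_ifs <;> ring
  | succ t ih =>
    obtain ⟨bY, bX, h1, h2⟩ := ih
    refine ⟨fun i j => ∑ k ∈ Finset.univ.filter (· ≠ j), bX k i
        + 2 * ⨆ q : {q : Fin n // q ≠ j}, (BPdiff n w t).2 q i,
      fun j i => ∑ k ∈ Finset.univ.filter (· ≠ i), bY k j
        + 2 * ⨆ q : {q : Fin n // q ≠ i}, (BPdiff n w t).1 q j, ?_, ?_⟩
    · intro i j r
      obtain ⟨e1, e2⟩ := step_aux hn j (fun q => w i q) (fun k => bX k i)
        (fun k => (BPdiff n w t).2 k i) (fun k q => (BPmsg n w t).2 k i q)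
        (fun k q => h2 k i q)
      simp only [BPmsg, BPdiff]
      rw [e1, e2]
      split_ifs <;> ring
    · intro j i r
      obtain ⟨e1, e2⟩ := step_aux hn i (fun q => w q j) (fun k => bY k j)
        (fun k => (BPdiff n w t).1 k j) (fun k q => (BPmsg n w t).1 k j q)
        (fun k q => h1 k j q)
      simp only [BPmsg, BPdiff]
      rw [e1, e2]
      split_ifs <;> ring

lemma belief_eq {n : ℕ} (hn : 2 ≤ n) (w : Fin n → Fin n → ℝ) (t : ℕ) (i : Fin n) :
    ∃ S : ℝ, ∀ r, belief n w t i r = S + 2 * (BPdiff n w t).2 r i := by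
  obtain ⟨bY, bX, h1, h2⟩ := BPmsg_eq hn w t
  refine ⟨∑ k, bX k i, fun r => ?_⟩
  simp only [belief, h2, Finset.sum_add_distrib, Finset.sum_ite_eq]
  simp only [Finset.mem_univ, if_true]
  ring

lemma BPdiff_bound {n : ℕ} (hn : 2 ≤ n) (w : Fin n → Fin n → ℝ)
    (hw : ∀ i j, w i j ∈ Set.Icc (0:ℝ) 1)
    (σ : Equiv.Perm (Fin n)) (π : Fin n → ℝ) (hπ1 : ∀ a, |π a| ≤ 1) (η : ℝ)
    (hπ : ∀ a b, a ≠ b → π b - π a ≤ w b (σ b) - w a (σ b) - η) (e : ℕ) (he : e ≤ 1) (k : ℕ) :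
    (∀ i r, r ≠ σ i → (BPdiff n w (2 * k + e)).2 r i ≤ π i + 2 - k * η) ∧
    (∀ i, π i - 2 + k * η ≤ (BPdiff n w (2 * k + e)).2 (σ i) i) := by
  induction k with
  | zero =>
    have hX : ∀ r i, (BPdiff n w (2 * 0 + e)).2 r i ∈ Set.Icc (-1:ℝ) 1 := by
      intro r i
      obtain ⟨h0, h1⟩ := hw i r
      interval_cases e
      · simp only [BPdiff]
        exact ⟨by linarith, h1⟩
      · have := ne_nonempty hn i
        simp only [BPdiff]
        have a1 : (⨆ q : {q : Fin n // q ≠ i}, w q r) ≤ 1 := ciSup_le fun q => (hw q r).2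
        have a2 : 0 ≤ (⨆ q : {q : Fin n // q ≠ i}, w q r) :=
          Real.iSup_nonneg fun q => (hw q r).1
        exact ⟨by linarith, by linarith⟩
    constructor
    · intro i r _
      have := abs_le.1 (hπ1 i)
      have := hX r i
      simp only [Set.mem_Icc] at this
      push_cast
      linarith
    · intro i
      have := abs_le.1 (hπ1 i)
      have := hX (σ i) i
      simp only [Set.mem_Icc] at this
      push_cast
      linarith
  | succ k ih =>
    obtain ⟨ih1, ih2⟩ := ih
    have e2 : 2 * (k + 1) + e = (2 * k + e) + 1 + 1 := by ring
    rw [e2]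
    generalize 2 * k + e = s at ih1 ih2
    constructor
    · intro i r hr
      obtain ⟨b, rfl⟩ := σ.surjective r
      have hb : b ≠ i := fun h => hr (by rw [h])
      have h1 := le_ciSup (f := fun q : {q : Fin n // q ≠ i} => (BPdiff n w (s+1)).1 q (σ b))
        (Set.finite_range _).bddAbove ⟨b, hb⟩
      have := ne_nonempty hn (σ b)
      have h2 : (⨆ q : {q : Fin n // q ≠ σ b}, (BPdiff n w s).2 q b) ≤ π b + 2 - k * η :=
        ciSup_le fun q => ih1 b q q.2
      have h3 := hπ i b hb.symm
      have h4 : (BPdiff n w (s+1)).1 b (σ b) =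
        w b (σ b) - ⨆ q : {q : Fin n // q ≠ σ b}, (BPdiff n w s).2 q b := rfl
      have h5 : (BPdiff n w (s+1+1)).2 (σ b) i =
        w i (σ b) - ⨆ q : {q : Fin n // q ≠ i}, (BPdiff n w (s+1)).1 q (σ b) := rfl
      simp only at h1
      rw [h5]
      push_cast
      linarith
    · intro i
      have := ne_nonempty hn i
      have h1 : (⨆ q : {q : Fin n // q ≠ i}, (BPdiff n w (s+1)).1 q (σ i)) ≤
          w i (σ i) - (π i - 2 + (k + 1) * η) := by
        apply ciSup_le
        rintro ⟨q, hq⟩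
        have h4 : (BPdiff n w (s+1)).1 q (σ i) =
          w q (σ i) - ⨆ r : {r : Fin n // r ≠ σ i}, (BPdiff n w s).2 r q := rfl
        have h6 := le_ciSup (f := fun r : {r : Fin n // r ≠ σ i} => (BPdiff n w s).2 r q)
          (Set.finite_range _).bddAbove ⟨σ q, fun h => hq (σ.injective h)⟩
        have h7 := ih2 q
        have h3 := hπ q i hq
        simp only at h6 ⊢
        rw [h4]
        linarith
      have h5 : (BPdiff n w (s+1+1)).2 (σ i) i =
        w i (σ i) - ⨆ q : {q : Fin n // q ≠ i}, (BPdiff n w (s+1)).1 q (σ i) := rfl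
      rw [h5]
      push_cast
      linarith

lemma exists_perm_of_matching {n : ℕ} (w : Fin n → Fin n → ℝ)
    (hw : ∀ i j, w i j ∈ Set.Icc (0:ℝ) 1) (M : Finset (Fin n × Fin n)) (hM : IsMatching n M)
    (hmax : ∀ M', IsMatching n M' → M' ≠ M → matchingWeight n w M' < matchingWeight n w M) :
    ∃ σ : Equiv.Perm (Fin n), M = Finset.univ.image (fun i => (i, σ i)) := by
  classical
  have inj1 : Set.InjOn Prod.fst (M : Set (Fin n × Fin n)) := by
    intro p hp q hq h
    by_contra hne
    exact (hM p hp q hq hne).1 h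
  have inj2 : Set.InjOn Prod.snd (M : Set (Fin n × Fin n)) := by
    intro p hp q hq h
    by_contra hne
    exact (hM p hp q hq hne).2 h
  have c1 : (M.image Prod.fst).card = M.card := Finset.card_image_of_injOn inj1
  have c2 : (M.image Prod.snd).card = M.card := Finset.card_image_of_injOn inj2
  have hall : M.card = n := by
    by_contra hne
    have hlt : M.card < n := by
      refine lt_of_le_of_ne ?_ hne
      rw [← c1]
      simpa using Finset.card_le_univ (M.image Prod.fst)
    obtain ⟨i, hi⟩ : ∃ i, i ∉ M.image Prod.fst := by
      by_contra! h
      have : M.image Prod.fst = Finset.univ := Finset.eq_univ_iff_forall.2 h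
      rw [this] at c1
      simp at c1
      omega
    obtain ⟨j, hj⟩ : ∃ i, i ∉ M.image Prod.snd := by
      by_contra! h
      have : M.image Prod.snd = Finset.univ := Finset.eq_univ_iff_forall.2 h
      rw [this] at c2
      simp at c2
      omega
    have hi' : ∀ p ∈ M, p.1 ≠ i := fun p hp h => hi (Finset.mem_image.2 ⟨p, hp, h⟩)
    have hj' : ∀ p ∈ M, p.2 ≠ j := fun p hp h => hj (Finset.mem_image.2 ⟨p, hp, h⟩)
    have hnot : (i, j) ∉ M := fun h => hi' _ h rfl
    have := hmax (insert (i, j) M) (by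
      intro p hp q hq hpq
      rcases Finset.mem_insert.1 hp with rfl | hp
      · rcases Finset.mem_insert.1 hq with rfl | hq
        · exact absurd rfl hpq
        · exact ⟨(hi' q hq).symm, (hj' q hq).symm⟩
      · rcases Finset.mem_insert.1 hq with rfl | hq
        · exact ⟨hi' p hp, hj' p hp⟩
        · exact hM p hp q hq hpq) (fun h => hnot (h ▸ Finset.mem_insert_self _ _))
    simp only [matchingWeight] at this
    rw [Finset.sum_insert hnot] at this
    have := (hw i j).1
    simp only at *
    linarith
  have him : M.image Prod.fst = Finset.univ := by
    apply Finset.eq_univ_of_card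
    rw [c1, hall]; simp
  have hex : ∀ i, ∃ j, (i, j) ∈ M := by
    intro i
    have : i ∈ M.image Prod.fst := him ▸ Finset.mem_univ i
    obtain ⟨⟨a, b⟩, hp, rfl⟩ := Finset.mem_image.1 this
    exact ⟨b, hp⟩
  choose s hs using hex
  have hsi : Function.Injective s := by
    intro a b hab
    have := inj2 (hs a) (hs b) hab
    exact congrArg Prod.fst this
  refine ⟨Equiv.ofBijective s (Finite.injective_iff_bijective.1 hsi), ?_⟩
  ext ⟨a, b⟩
  simp only [Finset.mem_image, Finset.mem_univ, true_and, Equiv.ofBijective_apply, Prod.mk.injEq]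
  constructor
  · intro h
    refine ⟨a, rfl, ?_⟩
    have := inj1 (hs a) h rfl
    exact congrArg Prod.snd this
  · rintro ⟨_, rfl, rfl⟩
    exact hs _

lemma perm_matching {n : ℕ} (σ : Equiv.Perm (Fin n)) :
    IsMatching n (Finset.univ.image (fun i => (i, σ i))) := by
  intro p hp q hq hpq
  simp only [Finset.mem_image, Finset.mem_univ, true_and] at hp hq
  obtain ⟨a, rfl⟩ := hp
  obtain ⟨b, rfl⟩ := hq
  have : a ≠ b := fun h => hpq (by rw [h])
  exact ⟨this, fun h => this (σ.injective h)⟩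

lemma perm_weight {n : ℕ} (w : Fin n → Fin n → ℝ) (σ : Equiv.Perm (Fin n)) :
    matchingWeight n w (Finset.univ.image (fun i => (i, σ i))) = ∑ i, w i (σ i) := by
  rw [matchingWeight, Finset.sum_image]
  intro a _ b _ h
  exact congrArg Prod.fst h

/-- Convergence from a gap `8 n / t`. -/
lemma converged_of_gap {n : ℕ} (w : Fin n → Fin n → ℝ)
    (hw : ∀ i j, w i j ∈ Set.Icc (0:ℝ) 1) (t : ℕ) (ht : 1 ≤ t)
    (M : Finset (Fin n × Fin n)) (hM : IsMatching n M)
    (hgap : ∀ M', IsMatching n M' → M' ≠ M →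
      matchingWeight n w M' ≤ matchingWeight n w M - 8 * n / t) :
    BPConvergedBy n w (t - 1) := by
  classical
  rcases Nat.eq_zero_or_pos n with h0 | hn0
  · subst h0
    refine ⟨M, hM, fun M' _ h => absurd (Subsingleton.elim _ _) h, fun s _ i => i.elim0⟩
  have htR : (0:ℝ) < t := by exact_mod_cast ht
  have hnR : (0:ℝ) < n := by exact_mod_cast hn0
  have hδ : (0:ℝ) < 8 * n / t := by positivity
  have hmax : ∀ M', IsMatching n M' → M' ≠ M → matchingWeight n w M' < matchingWeight n w M :=
    fun M' h1 h2 => by linarith [hgap M' h1 h2]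
  refine ⟨M, hM, hmax, ?_⟩
  obtain ⟨σ, rfl⟩ := exists_perm_of_matching w hw M hM hmax
  intro s hs i
  refine ⟨σ i, Finset.mem_image.2 ⟨i, Finset.mem_univ _, rfl⟩, ?_⟩
  intro r hr
  have hn : 2 ≤ n := by
    by_contra h
    have : n = 1 := by omega
    subst this
    exact hr (Subsingleton.elim _ _)
  -- the gap is at most one
  have hδ1 : 8 * n / t ≤ (1:ℝ) := by
    have hmem : (i, σ i) ∈ Finset.univ.image (fun i => (i, σ i)) :=
      Finset.mem_image.2 ⟨i, Finset.mem_univ _, rfl⟩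
    have := hgap ((Finset.univ.image (fun i => (i, σ i))).erase (i, σ i))
      (fun p hp q hq => hM p (Finset.mem_of_mem_erase hp) q (Finset.mem_of_mem_erase hq))
      (fun h => Finset.notMem_erase (i, σ i) (Finset.univ.image (fun i => (i, σ i))) (by
        rw [h]; exact hmem))
    have h2 : matchingWeight n w ((Finset.univ.image (fun i => (i, σ i))).erase (i, σ i)) + w i (σ i)
        = matchingWeight n w (Finset.univ.image (fun i => (i, σ i))) :=
      Finset.sum_erase_add _ _ hmem
    have := (hw i (σ i)).2
    linarith
  have ht8 : (8:ℝ) * n ≤ t := by rwa [div_le_one htR] at hδ1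
  have ht16 : (16:ℝ) ≤ t := by
    have : (2:ℝ) ≤ n := by exact_mod_cast hn
    linarith
  set η : ℝ := 8 / t with hη
  have hη0 : 0 < η := by positivity
  have hηn : 8 * n / t = n * η := by rw [hη]; ring
  obtain ⟨π, hπ⟩ := exists_potential (fun a b => w a (σ b) + if a = b then 0 else η) (by
    intro ρ
    by_cases hρ : ρ = 1
    · subst hρ; simp
    have h1 := hgap _ (perm_matching (ρ.trans σ)) (by
      intro h
      apply hρ
      ext1 a
      have : (a, σ (ρ a)) ∈ Finset.univ.image (fun i => (i, σ i)) := by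
        rw [← h]; exact Finset.mem_image.2 ⟨a, Finset.mem_univ _, rfl⟩
      obtain ⟨b, _, hb⟩ := Finset.mem_image.1 this
      simp only [Prod.mk.injEq] at hb
      obtain ⟨rfl, hb⟩ := hb
      exact (σ.injective hb).symm)
    rw [perm_weight, perm_weight, hηn] at h1
    simp only [Equiv.trans_apply] at h1
    have h2 : ∑ a, (if a = ρ a then (0:ℝ) else η) ≤ n * η := by
      calc _ ≤ ∑ a : Fin n, η := Finset.sum_le_sum fun a _ => by split_ifs <;> linarith
        _ = _ := by simp
    simp only [Finset.sum_add_distrib, if_true, Finset.sum_const_zero]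
    linarith)
  have hπ' : ∀ a b, a ≠ b → π b - π a ≤ w b (σ b) - w a (σ b) - η := by
    intro a b hab
    have := hπ a b
    simp only [if_true, if_neg hab] at this
    linarith
  have hrange : ∀ a b, π b - π a ≤ 1 := by
    intro a b
    by_cases hab : a = b
    · subst hab; simp
    have := hπ' a b hab
    have := (hw b (σ b)).2
    have := (hw a (σ b)).1
    linarith
  obtain ⟨hA, hB⟩ := BPdiff_bound hn w hw σ (fun a => π a - π i)
    (fun a => abs_le.2 ⟨by linarith [hrange a i], hrange i a⟩) η
    (fun a b hab => by linarith [hπ' a b hab]) (s % 2) (by omega) (s / 2)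
  rw [Nat.div_add_mod] at hA hB
  have hA := hA i r hr
  have hB := hB i
  obtain ⟨S, hS⟩ := belief_eq hn w s i
  rw [hS, hS]
  have hk : (t:ℝ) - 2 ≤ 2 * ((s / 2 : ℕ) : ℝ) := by
    have : t ≤ 2 * (s / 2) + 2 := by omega
    have : (t:ℝ) ≤ 2 * ((s / 2 : ℕ) : ℝ) + 2 := by exact_mod_cast this
    linarith
  have hkη : 2 < ((s / 2 : ℕ) : ℝ) * η := by
    rw [hη, mul_div_assoc', lt_div_iff₀ htR]
    linarith
  linarith

lemma pi_coord_bound {ι : Type*} [Fintype ι] [DecidableEq ι] (μ : ι → Measure ℝ)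
    [∀ i, IsProbabilityMeasure (μ i)] (p : ι) (c : (ι → ℝ) → ℝ) (hc : Measurable c)
    (hcp : ∀ w x, c (Function.update w p x) = c w) (δ : ℝ) (B : ENNReal)
    (hB : ∀ y, μ p (Set.Icc (y - δ) (y + δ)) ≤ B) :
    Measure.pi μ {w | w p ∈ Set.Icc (c w - δ) (c w + δ)} ≤ B := by
  have hS : MeasurableSet {w : ι → ℝ | w p ∈ Set.Icc (c w - δ) (c w + δ)} := by
    have h1 : MeasurableSet {w : ι → ℝ | c w - δ ≤ w p} :=
      measurableSet_le (hc.sub_const δ) (measurable_pi_apply p)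
    have h2 : MeasurableSet {w : ι → ℝ | w p ≤ c w + δ} :=
      measurableSet_le (measurable_pi_apply p) (hc.add_const δ)
    exact h1.inter h2
  rw [← lintegral_indicator_one hS]
  calc _ ≤ ∫⁻ _, B ∂Measure.pi μ := by
        apply lintegral_le_of_lmarginal_le {p}
        · exact measurable_one.indicator hS
        · exact measurable_const
        · rw [lmarginal_singleton, lmarginal_singleton]
          intro x
          simp only [lintegral_const, measure_univ, mul_one]
          refine le_trans (le_of_eq ?_) (hB (c x))
          rw [← lintegral_indicator_one measurableSet_Icc]
          congr 1
          ext y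
          simp only [Set.indicator, Set.mem_ofPred_eq, hcp, Function.update_self, Pi.one_apply]
    _ = B := by simp

/-- The set of matchings is finite. -/
noncomputable def matchings (n : ℕ) : Finset (Finset (Fin n × Fin n)) := by
  classical exact Finset.univ.filter (IsMatching n)

lemma mem_matchings {n : ℕ} {M : Finset (Fin n × Fin n)} : M ∈ matchings n ↔ IsMatching n M := by
  classical simp [matchings]

lemma matchings_avoid_nonempty {n : ℕ} (p : Fin n × Fin n) :
    ((matchings n).filter (p ∉ ·)).Nonempty :=
  ⟨∅, by simp [mem_matchings, IsMatching]⟩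

lemma matchings_contain_nonempty {n : ℕ} (p : Fin n × Fin n) :
    ((matchings n).filter (p ∈ ·)).Nonempty :=
  ⟨{p}, by simp [mem_matchings, IsMatching]⟩

/-- Threshold for the weight of the edge `p`. -/
noncomputable def threshold (n : ℕ) (p : Fin n × Fin n) (w : Fin n × Fin n → ℝ) : ℝ :=
  ((matchings n).filter (p ∉ ·)).sup' (matchings_avoid_nonempty p) (fun M => ∑ q ∈ M, w q) -
  ((matchings n).filter (p ∈ ·)).sup' (matchings_contain_nonempty p)
    (fun M => ∑ q ∈ M.erase p, w q)

lemma threshold_measurable (n : ℕ) (p : Fin n × Fin n) : Measurable (threshold n p) := by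
  unfold threshold
  apply Measurable.sub
  · simp_rw [← Finset.sup'_apply]
    apply Finset.measurable_sup'
    intro M _
    exact Finset.measurable_sum _ fun q _ => measurable_pi_apply q
  · simp_rw [← Finset.sup'_apply]
    apply Finset.measurable_sup'
    intro M _
    exact Finset.measurable_sum _ fun q _ => measurable_pi_apply q

lemma threshold_update (n : ℕ) (p : Fin n × Fin n) (w : Fin n × Fin n → ℝ) (x : ℝ) :
    threshold n p (Function.update w p x) = threshold n p w := by
  unfold threshold
  congr 1
  · refine Finset.sup'_congr _ rfl fun M hM => Finset.sum_congr rfl fun q hq => ?_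
    rw [Function.update_of_ne]
    rintro rfl
    exact (Finset.mem_filter.1 hM).2 hq
  · refine Finset.sup'_congr _ rfl fun M hM => Finset.sum_congr rfl fun q hq => ?_
    rw [Function.update_of_ne (Finset.ne_of_mem_erase hq)]

/-- If one of two nearly optimal matchings contains `p` and the other does not, then
the weight of `p` is near the threshold. -/
lemma near_threshold {n : ℕ} (w : Fin n × Fin n → ℝ) (p : Fin n × Fin n) (δ V : ℝ)
    (hV : ∀ M, IsMatching n M → ∑ q ∈ M, w q ≤ V)
    (M M' : Finset (Fin n × Fin n)) (hM : IsMatching n M) (hM' : IsMatching n M')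
    (h1 : V - δ ≤ ∑ q ∈ M, w q) (h2 : V - δ ≤ ∑ q ∈ M', w q) (hp : p ∈ M) (hp' : p ∉ M') :
    w p ∈ Set.Icc (threshold n p w - δ) (threshold n p w + δ) := by
  unfold threshold
  set A := ((matchings n).filter (p ∉ ·)).sup' (matchings_avoid_nonempty p)
    (fun M => ∑ q ∈ M, w q) with hA
  set B := ((matchings n).filter (p ∈ ·)).sup' (matchings_contain_nonempty p)
    (fun M => ∑ q ∈ M.erase p, w q) with hB
  have a1 : A ≤ V := Finset.sup'_le _ _ fun N hN =>
    hV N (mem_matchings.1 (Finset.mem_filter.1 hN).1)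
  have a2 : V - δ ≤ A := h2.trans (Finset.le_sup' (fun M => ∑ q ∈ M, w q)
    (Finset.mem_filter.2 ⟨mem_matchings.2 hM', hp'⟩))
  have b1 : B ≤ V - w p := Finset.sup'_le _ _ fun N hN => by
    have := hV N (mem_matchings.1 (Finset.mem_filter.1 hN).1)
    rw [← Finset.sum_erase_add _ _ (Finset.mem_filter.1 hN).2] at this
    linarith
  have b2 : V - δ - w p ≤ B := by
    refine le_trans ?_ (Finset.le_sup' (fun M => ∑ q ∈ M.erase p, w q)
      (Finset.mem_filter.2 ⟨mem_matchings.2 hM, hp⟩))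
    rw [← Finset.sum_erase_add _ _ hp] at h1
    linarith
  constructor <;> linarith

lemma isolation {n : ℕ} (w : Fin n × Fin n → ℝ) (δ : ℝ) (hδ : 0 ≤ δ)
    (h : ∀ p, w p ∉ Set.Icc (threshold n p w - δ) (threshold n p w + δ)) :
    ∃ M, IsMatching n M ∧ ∀ M', IsMatching n M' → M' ≠ M →
      ∑ q ∈ M', w q ≤ ∑ q ∈ M, w q - δ := by
  classical
  obtain ⟨M, hM, hmax⟩ := (matchings n).exists_max_image (fun M => ∑ q ∈ M, w q)
    ⟨∅, by simp [mem_matchings, IsMatching]⟩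
  rw [mem_matchings] at hM
  have hV : ∀ N, IsMatching n N → ∑ q ∈ N, w q ≤ ∑ q ∈ M, w q :=
    fun N hN => hmax N (mem_matchings.2 hN)
  refine ⟨M, hM, fun M' hM' hne => ?_⟩
  by_contra! hlt
  apply hne
  ext p
  constructor
  · intro hp
    by_contra hp'
    exact h p (near_threshold w p δ _ hV M' M hM' hM hlt.le (by linarith) hp hp')
  · intro hp
    by_contra hnp
    exact h p (near_threshold w p δ _ hV M M' hM hM' (by linarith) hlt.le hp hnp)

/-- **Upper tail bound for BP for maximum-weight bipartite matching.** If the edge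
weights of `K_{n,n}` (with `m = n²` edges) are independent random variables with
values in `[0,1]` whose densities are bounded by `φ`, then there is an absolute
constant `C > 0` such that for every `t ≥ 1` the probability that BP needs at least
`t` iterations to converge (i.e. has not converged by iteration `t - 1`) is at most
`C · n · m · φ / t`. -/
theorem bp_matching_upper_tail :
    ∃ C : ℝ, 0 < C ∧
      ∀ (n : ℕ) (φ : ℝ) (g : Fin n × Fin n → ℝ → ENNReal),
        (∀ p, Measurable (g p)) →
        (∀ p x, g p x ≤ ENNReal.ofReal φ) →
        (∀ p x, x ∉ Set.Icc (0 : ℝ) 1 → g p x = 0) →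
        (∀ p, IsProbabilityMeasure ((volume : Measure ℝ).withDensity (g p))) →
        ∀ t : ℕ, 1 ≤ t →
          Measure.pi (fun p : Fin n × Fin n => (volume : Measure ℝ).withDensity (g p))
              {w : Fin n × Fin n → ℝ | ¬ BPConvergedBy n (fun i j => w (i, j)) (t - 1)} ≤
            ENNReal.ofReal (C * n * (n ^ 2 : ℕ) * φ / t) := by
  refine ⟨16, by norm_num, ?_⟩
  intro n φ g hg hφ hsupp hprob t ht
  set μ : Fin n × Fin n → Measure ℝ := fun p => (volume : Measure ℝ).withDensity (g p) with hμ
  have : ∀ p, IsProbabilityMeasure (μ p) := hprob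
  set δ : ℝ := 8 * n / t with hδ
  have hδ0 : 0 ≤ δ := by positivity
  have hsub : {w : Fin n × Fin n → ℝ | ¬ BPConvergedBy n (fun i j => w (i, j)) (t - 1)} ⊆
      (⋃ p, {w | w p ∈ Set.Icc (threshold n p w - δ) (threshold n p w + δ)}) ∪
      (⋃ p, Function.eval p ⁻¹' (Set.Icc (0:ℝ) 1)ᶜ) := by
    intro w hw
    by_contra hcon
    simp only [Set.mem_union, Set.mem_iUnion, Set.mem_ofPred_eq, Set.mem_preimage,
      Set.mem_compl_iff, Function.eval, not_or, not_exists, not_not] at hcon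
    obtain ⟨h1, h2⟩ := hcon
    obtain ⟨M, hM, hgap⟩ := isolation w δ hδ0 h1
    exact hw (converged_of_gap (fun i j => w (i, j)) (fun i j => h2 (i, j)) t ht M hM
      (fun M' hM' hne => hgap M' hM' hne))
  have hnull : Measure.pi μ (⋃ p, Function.eval p ⁻¹' (Set.Icc (0:ℝ) 1)ᶜ) = 0 := by
    rw [measure_iUnion_null_iff]
    intro p
    apply Measure.pi_eval_preimage_null
    rw [hμ, withDensity_apply _ measurableSet_Icc.compl]
    rw [setLIntegral_congr_fun (g := fun _ => 0) measurableSet_Icc.compl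
      (fun x hx => hsupp p x hx)]
    simp
  have hB : ∀ p y, μ p (Set.Icc (y - δ) (y + δ)) ≤ ENNReal.ofReal (φ * (2 * δ)) := by
    intro p y
    rw [hμ, withDensity_apply _ measurableSet_Icc]
    calc _ ≤ ∫⁻ _ in Set.Icc (y - δ) (y + δ), ENNReal.ofReal φ := lintegral_mono (hφ p)
      _ = ENNReal.ofReal φ * ENNReal.ofReal (2 * δ) := by
        rw [setLIntegral_const, Real.volume_Icc]
        congr 2
        ring
      _ = _ := (ENNReal.ofReal_mul' (by positivity)).symm
  calc _ ≤ _ := measure_mono hsub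
    _ ≤ _ := measure_union_le _ _
    _ = Measure.pi μ (⋃ p, {w | w p ∈ Set.Icc (threshold n p w - δ) (threshold n p w + δ)}) := by
      rw [hnull, add_zero]
    _ ≤ ∑ p, Measure.pi μ {w | w p ∈ Set.Icc (threshold n p w - δ) (threshold n p w + δ)} :=
      measure_iUnion_fintype_le _ _
    _ ≤ ∑ p : Fin n × Fin n, ENNReal.ofReal (φ * (2 * δ)) :=
      Finset.sum_le_sum fun p _ => pi_coord_bound μ p _ (threshold_measurable n p)
        (threshold_update n p) δ _ (hB p)
    _ = ENNReal.ofReal (16 * n * (n ^ 2 : ℕ) * φ / t) := by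
      simp only [Finset.sum_const, Finset.card_univ, Fintype.card_prod, Fintype.card_fin]
      rw [← ENNReal.ofReal_nsmul]
      congr 1
      rw [hδ, nsmul_eq_mul]
      push_cast
      ring
end

section
/- Let φ ≥ 26 and let n ≥ 2 be even. Consider the complete bipartite graph K_{n,n} whose node sets are partitioned into n/2 groups of four nodes {u_1^j, u_2^j, v_1^j, v_2^j} (j = 1,…,n/2), where the edges inside one group (heavy edges) and the edges between different groups (light edges) satisfy: every light edge has weight in [0, 1/φ] and every heavy edge has weight in [20/26 − 1/φ, 1]. Then for every node x of K_{n,n} and every level k ≥ 0, a maximum-weight T-matching Λ* in the computation tree T^k(x) does not contain any light edge. -/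
/-- A node of `K_{n,n}`: `Sum.inl i` is the node `u_{i+1}` on the `U`-side and
`Sum.inr j` is the node `v_{j+1}` on the `V`-side. -/
abbrev KnnNode (n : ℕ) := Fin n ⊕ Fin n

/-- Adjacency in the complete bipartite graph `K_{n,n}`: every `U`-node is adjacent to
every `V`-node. -/
def KnnAdj {n : ℕ} (a b : KnnNode n) : Prop := a.isLeft ≠ b.isLeft

/-- The weight of the edge between two nodes of `K_{n,n}` (junk value `0` for
non-adjacent pairs). -/
def nodeWeight {n : ℕ} (w : Fin n → Fin n → ℝ) : KnnNode n → KnnNode n → ℝ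
  | Sum.inl i, Sum.inr j => w i j
  | Sum.inr j, Sum.inl i => w i j
  | _, _ => 0

/-- A vertex of the level-`k` computation tree `T^k(x)`: a non-backtracking walk in
`K_{n,n}` starting at `x` with at most `k + 1` edges (so at most `k + 2` nodes),
recorded as the list of visited nodes. The root is the walk `[x]`, and the parent of a
longer walk is obtained by dropping its last node. -/
def IsCTVertex (n k : ℕ) (x : KnnNode n) (L : List (KnnNode n)) : Prop :=
  L ≠ [] ∧ L.length ≤ k + 2 ∧ L.head? = some x ∧
  (∀ (i : ℕ) (a b : KnnNode n), L[i]? = some a → L[i + 1]? = some b → KnnAdj a b) ∧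
  (∀ (i : ℕ) (a c : KnnNode n), L[i]? = some a → L[i + 2]? = some c → a ≠ c)

/-- An edge of the computation tree is represented by its lower endpoint `L` (a walk
with at least one edge); its endpoints are the tree vertices `L.dropLast` and `L`, and
its weight is the weight of the `K_{n,n}`-edge between the last two nodes of `L`. -/
noncomputable def ctEdgeWeight {n : ℕ} (w : Fin n → Fin n → ℝ)
    (L : List (KnnNode n)) : ℝ :=
  match L.dropLast.getLast?, L.getLast? with
  | some a, some b => nodeWeight w a b
  | _, _ => 0

/-- A `T`-matching in the computation tree `T^k(x)`: a collection `Λ` of tree edges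
(each represented by its lower endpoint) such that no two edges of `Λ` are adjacent in
the tree and every non-leaf vertex of `T^k(x)` is an endpoint of exactly one edge of
`Λ` (leaves may be endpoints of one or zero edges). -/
def IsTMatching (n k : ℕ) (x : KnnNode n) (Λ : Finset (List (KnnNode n))) : Prop :=
  (∀ L ∈ Λ, IsCTVertex n k x L ∧ 2 ≤ L.length) ∧
  (∀ L₁ ∈ Λ, ∀ L₂ ∈ Λ, L₁ ≠ L₂ →
    ¬(L₁.dropLast = L₂.dropLast ∨ L₁.dropLast = L₂ ∨ L₁ = L₂.dropLast)) ∧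
  (∀ L : List (KnnNode n), IsCTVertex n k x L → L.length ≤ k + 1 →
    ∃! L', L' ∈ Λ ∧ (L' = L ∨ L'.dropLast = L))

/-- The weight of a `T`-matching. -/
noncomputable def tMatchingWeight {n : ℕ} (w : Fin n → Fin n → ℝ)
    (Λ : Finset (List (KnnNode n))) : ℝ :=
  ∑ L ∈ Λ, ctEdgeWeight w L

/-- An edge of `K_{n,n}` is light if its endpoints lie in different groups, where for
`n` even the nodes are partitioned into the `n/2` groups
`{u_{2j+1}, u_{2j+2}, v_{2j+1}, v_{2j+2}}` (i.e. `u`-index `i` and `v`-index `j` are in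
the same group iff `⌊i/2⌋ = ⌊j/2⌋`). -/
def IsLightPair {n : ℕ} (a b : KnnNode n) : Prop :=
  ∃ i j : Fin n, ((a = Sum.inl i ∧ b = Sum.inr j) ∨ (a = Sum.inr j ∧ b = Sum.inl i)) ∧
    (i : ℕ) / 2 ≠ (j : ℕ) / 2


lemma ctm_per (w : ℤ → ℝ) (hp : ∀ s, w (s + 4) = w s) (q i : ℤ) : w (i + 4 * q) = w i := by
  have : Function.Periodic w 4 := hp
  have := this.int_mul q i
  rw [← this]; congr 1; push_cast; ring

lemma ctm_seqA (w : ℤ → ℝ) (hp : ∀ s, w (s + 4) = w s) (hb : ∀ s, 19/26 ≤ w s ∧ w s ≤ 1)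
    (h m : ℕ)
    (hA : (h = 2 * m ∧ (m : ℝ) * (w 1 + w 3 - w 0 - w 2) ≤ 0) ∨
      (h = 2 * m + 1 ∧ (m : ℝ) * (w 1 + w 3 - w 0 - w 2) ≤ w 0 - w 1)) :
    ∃ F : ℤ → ℝ, (∀ j : ℤ, 0 ≤ j → j + 1 < h → w (2 * j + 1) - w (2 * j + 2) ≤ F j - F (j + 1)) ∧
      (0 < h → F 0 ≤ w 0) ∧ (0 < h → w (2 * h - 1) ≤ F (h - 1)) ∧
      (∀ j : ℤ, 0 ≤ j → j < h → 12/26 ≤ F j ∧ F j ≤ 1) := by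
  have hper' : ∀ (q : ℤ), 0 ≤ q → ∀ i, w (i + 4 * q) = w i :=
    fun q _ i => ctm_per w hp q i
  have h0 := hb 0
  have h1 := hb 1
  have h2 := hb 2
  have h3 := hb 3
  rcases hA with ⟨rfl, hA⟩ | ⟨rfl, hA⟩
  · refine ⟨fun j => if j % 2 = 0 then w 0 else w 3, ?_, ?_, ?_, ?_⟩
    · intro j hj hj2
      have hm : 0 < (m : ℝ) := by
        have : 0 < m := by push_cast at hj2; omega
        exact_mod_cast this
      have hD : w 1 + w 3 - w 0 - w 2 ≤ 0 := by
        by_contra hc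
        push Not at hc
        have := mul_pos hm hc
        linarith
      rcases Int.emod_two_eq_zero_or_one j with hj' | hj'
      · obtain ⟨q, rfl⟩ : ∃ q, j = 2 * q := ⟨j / 2, by omega⟩
        have e1 : w (2 * (2 * q) + 1) = w 1 := by
          rw [← hper' q (by omega) 1]; congr 1; ring
        have e2 : w (2 * (2 * q) + 2) = w 2 := by
          rw [← hper' q (by omega) 2]; congr 1; ring
        have e3 : (2 * q + 1) % 2 ≠ 0 := by omega
        simp only [hj', e3, if_true, if_false, e1, e2]
        linarith
      · obtain ⟨q, rfl⟩ : ∃ q, j = 2 * q + 1 := ⟨j / 2, by omega⟩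
        have e1 : w (2 * (2 * q + 1) + 1) = w 3 := by
          rw [← hper' q (by omega) 3]; congr 1; ring
        have e2 : w (2 * (2 * q + 1) + 2) = w 0 := by
          rw [← hper' (q + 1) (by omega) 0]; congr 1; ring
        have e3 : (2 * q + 1 + 1) % 2 = 0 := by omega
        have e4 : ¬ (2 * q + 1) % 2 = 0 := by omega
        simp only [e3, e4, if_true, if_false, e1, e2]
        linarith
    · intro _; simp
    · intro hm
      have e1 : w (2 * ((2 * m : ℕ) : ℤ) - 1) = w 3 := by
        rw [← hper' (m - 1) (by omega) 3]; congr 1; push_cast; ring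
      have e2 : ¬ (((2 * m : ℕ) : ℤ) - 1) % 2 = 0 := by omega
      simp only [e2, if_false, e1, le_refl]
    · intro j _ _
      dsimp only
      split_ifs <;> constructor <;> linarith
  · -- linear interpolation
    set D := w 1 + w 3 - w 0 - w 2 with hD
    set δ : ℝ := (w 1 - w 0) / m with hδ
    have hδm : ∀ q : ℤ, 0 ≤ q → q ≤ m → min (w 0) (w 1) ≤ w 0 + q * δ ∧
        w 0 + q * δ ≤ max (w 0) (w 1) := by
      intro q hq hqm
      rcases Nat.eq_zero_or_pos m with rfl | hm
      · have : q = 0 := by push_cast at hqm; omega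
        subst this
        simp
      · have hm' : (0 : ℝ) < m := by exact_mod_cast hm
        have hmδ : (m : ℝ) * δ = w 1 - w 0 := by rw [hδ]; field_simp
        have hq' : (0 : ℝ) ≤ q := by exact_mod_cast hq
        have hqm' : (q : ℝ) ≤ m := by exact_mod_cast hqm
        rcases le_total (w 0) (w 1) with hc | hc
        · rw [min_eq_left hc, max_eq_right hc]
          have : 0 ≤ δ := div_nonneg (by linarith) hm'.le
          constructor <;> nlinarith
        · rw [min_eq_right hc, max_eq_left hc]
          have : δ ≤ 0 := div_nonpos_of_nonpos_of_nonneg (by linarith) hm'.le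
          constructor <;> nlinarith
    have hstep : 0 < m → D ≤ -δ := by
      intro hm
      have hm' : (0 : ℝ) < m := by exact_mod_cast hm
      have hmδ : (m : ℝ) * δ = w 1 - w 0 := by rw [hδ]; field_simp
      by_contra hc
      push Not at hc
      nlinarith
    have hmax : max (w 0) (w 1) ≤ 1 := max_le h0.2 h1.2
    have hmin : 19/26 ≤ min (w 0) (w 1) := le_min h0.1 h1.1
    have hmax2 : 0 < m → w 3 - w 0 + max (w 0) (w 1) ≤ 1 := by
      intro hm
      have hm' : (0 : ℝ) < m := by exact_mod_cast hm
      rcases le_total (w 0) (w 1) with hc | hc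
      · rw [max_eq_right hc]
        have hDn : D ≤ 0 := by
          by_contra hc'
          push Not at hc'
          have := mul_pos hm' hc'
          linarith
        linarith
      · rw [max_eq_left hc]; linarith
    refine ⟨fun j => if j % 2 = 0 then w 0 + ((j / 2 : ℤ) : ℝ) * δ
      else w 3 - w 0 + (w 0 + ((j / 2 + 1 : ℤ) : ℝ) * δ), ?_, ?_, ?_, ?_⟩
    · intro j hj hj2
      have hm := hstep (by push_cast at hj2; omega)
      rcases Int.emod_two_eq_zero_or_one j with hj' | hj'
      · obtain ⟨q, rfl⟩ : ∃ q, j = 2 * q := ⟨j / 2, by omega⟩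
        have e1 : w (2 * (2 * q) + 1) = w 1 := by
          rw [← hper' q (by omega) 1]; congr 1; ring
        have e2 : w (2 * (2 * q) + 2) = w 2 := by
          rw [← hper' q (by omega) 2]; congr 1; ring
        have e3 : ¬ (2 * q + 1) % 2 = 0 := by omega
        have e4 : 2 * q / 2 = q := by omega
        have e5 : (2 * q + 1) / 2 = q := by omega
        simp only [hj', e3, if_true, if_false, e1, e2, e4, e5]
        push_cast
        linarith
      · obtain ⟨q, rfl⟩ : ∃ q, j = 2 * q + 1 := ⟨j / 2, by omega⟩
        have e1 : w (2 * (2 * q + 1) + 1) = w 3 := by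
          rw [← hper' q (by omega) 3]; congr 1; ring
        have e2 : w (2 * (2 * q + 1) + 2) = w 0 := by
          rw [← hper' (q + 1) (by omega) 0]; congr 1; ring
        have e3 : (2 * q + 1 + 1) % 2 = 0 := by omega
        have e4 : ¬ (2 * q + 1) % 2 = 0 := by omega
        have e5 : (2 * q + 1) / 2 = q := by omega
        have e6 : (2 * q + 1 + 1) / 2 = q + 1 := by omega
        simp only [e3, e4, if_true, if_false, e1, e2, e5, e6]
        push_cast
        linarith
    · intro _; simp
    · intro _
      have e1 : w (2 * ((2 * m + 1 : ℕ) : ℤ) - 1) = w 1 := by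
        rw [← hper' m (by omega) 1]; congr 1; push_cast; ring
      have e2 : (((2 * m + 1 : ℕ) : ℤ) - 1) % 2 = 0 := by omega
      have e3 : (((2 * m + 1 : ℕ) : ℤ) - 1) / 2 = m := by omega
      simp only [e2, if_true, e1, e3]
      rcases Nat.eq_zero_or_pos m with rfl | hm
      · simp at hA ⊢; linarith
      · have hm' : (0 : ℝ) < m := by exact_mod_cast hm
        have hmδ : (m : ℝ) * δ = w 1 - w 0 := by rw [hδ]; field_simp
        push_cast
        linarith
    · intro j hj hj2
      push_cast at hj2
      dsimp only
      split_ifs with hpar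
      · have := hδm (j / 2) (by omega) (by omega)
        constructor <;> linarith
      · have := hδm (j / 2 + 1) (by omega) (by omega)
        have := hmax2 (by omega)
        constructor <;> linarith

/-- Left-to-right version of the dual potentials on the path `0, …, 2h`. -/
lemma ctm_seqB (w : ℤ → ℝ) (hp : ∀ s, w (s + 4) = w s) (hb : ∀ s, 19/26 ≤ w s ∧ w s ≤ 1)
    (h m : ℕ)
    (hA : (h = 2 * m ∧ (m : ℝ) * (w 1 + w 3 - w 0 - w 2) ≤ 0) ∨
      (h = 2 * m + 1 ∧ (m : ℝ) * (w 1 + w 3 - w 0 - w 2) ≤ w 0 - w 1)) :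
    ∃ y : ℤ → ℝ, (∀ i : ℤ, 0 ≤ i → i < 2 * h → w i ≤ y i + y (i + 1)) ∧
      (∀ i : ℤ, 0 ≤ i → i < 2 * h → i % 2 = 0 → w i = y i + y (i + 1)) ∧
      (∀ i : ℤ, 0 ≤ i → i ≤ 2 * h → i % 2 = 0 → -7/26 ≤ y i) ∧
      (∀ i : ℤ, 0 ≤ i → i ≤ 2 * h → i % 2 = 1 → 12/26 ≤ y i) ∧
      0 ≤ y 0 ∧ y (2 * h) = 0 := by
  obtain ⟨F, h1, h2, h3, h4⟩ := ctm_seqA w hp hb h m hA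
  set y : ℤ → ℝ := fun i => if i = 2 * h then 0 else if i % 2 = 1 then F (i / 2)
    else w i - F (i / 2) with hy
  have yo : ∀ q : ℤ, y (2 * q + 1) = F q := by
    intro q
    have e1 : ¬ (2 * q + 1 = 2 * (h : ℤ)) := by omega
    have e2 : (2 * q + 1) % 2 = 1 := by omega
    have e3 : (2 * q + 1) / 2 = q := by omega
    simp only [hy, e1, e2, e3, if_true, if_false]
  have ye : ∀ q : ℤ, q ≠ h → y (2 * q) = w (2 * q) - F q := by
    intro q hq
    have e1 : ¬ (2 * q = 2 * (h : ℤ)) := by omega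
    have e2 : ¬ (2 * q) % 2 = 1 := by omega
    have e3 : (2 * q) / 2 = q := by omega
    simp only [hy, e1, e2, e3, if_false]
  have yl : y (2 * h) = 0 := by simp [hy]
  have heq : ∀ i : ℤ, 0 ≤ i → i < 2 * h → i % 2 = 0 → w i = y i + y (i + 1) := by
    intro i hi hi2 hi3
    obtain ⟨q, rfl⟩ : ∃ q, i = 2 * q := ⟨i / 2, by omega⟩
    rw [yo, ye q (by omega)]; ring
  refine ⟨y, ?_, heq, ?_, ?_, ?_, yl⟩
  · intro i hi hi2
    rcases Int.emod_two_eq_zero_or_one i with hi3 | hi3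
    · exact (heq i hi hi2 hi3).le
    · obtain ⟨q, rfl⟩ : ∃ q, i = 2 * q + 1 := ⟨i / 2, by omega⟩
      have e : 2 * q + 1 + 1 = 2 * (q + 1) := by ring
      rw [yo, e]
      by_cases hq : q + 1 = h
      · rw [hq, yl]
        have := h3 (by omega)
        have e1 : 2 * (h : ℤ) - 1 = 2 * q + 1 := by omega
        have e2 : (h : ℤ) - 1 = q := by omega
        rw [e1, e2] at this
        linarith
      · rw [ye _ hq]
        have := h1 q (by omega) (by omega)
        have e1 : 2 * (q + 1) = 2 * q + 2 := by ring
        rw [e1]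
        linarith
  · intro i hi hi2 hi3
    obtain ⟨q, rfl⟩ : ∃ q, i = 2 * q := ⟨i / 2, by omega⟩
    by_cases hq : q = h
    · rw [hq, yl]; norm_num
    · rw [ye q hq]
      have := h4 q (by omega) (by omega)
      have := hb (2 * q)
      linarith
  · intro i hi hi2 hi3
    obtain ⟨q, rfl⟩ : ∃ q, i = 2 * q + 1 := ⟨i / 2, by omega⟩
    rw [yo]
    exact (h4 q (by omega) (by omega)).1
  · rcases Nat.eq_zero_or_pos h with h0 | h0
    · have := yl
      rw [h0] at this
      simp at this
      rw [this]
    · have := ye 0 (by omega)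
      have := h2 h0
      simp at *
      linarith

/-- Dual potentials on a heavy path centered at its top vertex. -/
lemma ctm_seq (W : ℤ → ℝ) (hp : ∀ s, W (s + 4) = W s) (hb : ∀ s, 19/26 ≤ W s ∧ W s ≤ 1)
    (h : ℕ) : ∃ (ε : ℤ) (y : ℤ → ℝ),
      (∀ s : ℤ, -h ≤ s → s < h → W s ≤ y s + y (s + 1)) ∧
      (∀ s : ℤ, -h ≤ s → s < h → (s + h + ε) % 2 = 0 → W s = y s + y (s + 1)) ∧
      (∀ s : ℤ, -h ≤ s → s ≤ h → (s + h) % 2 = 0 → -7/26 ≤ y s) ∧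
      (∀ s : ℤ, -h ≤ s → s ≤ h → (s + h) % 2 = 1 → 12/26 ≤ y s) ∧
      0 ≤ y h ∧ 0 ≤ y (-h) ∧ (ε % 2 = 0 → y h = 0) ∧ (ε % 2 = 1 → y (-h) = 0) := by
  obtain ⟨m, hm⟩ : ∃ m, h = 2 * m ∨ h = 2 * m + 1 := ⟨h / 2, by omega⟩
  set w : ℤ → ℝ := fun i => W (i - h) with hw
  set w' : ℤ → ℝ := fun i => W (h - 1 - i) with hw'
  have key : ((h = 2 * m ∧ (m : ℝ) * (w 1 + w 3 - w 0 - w 2) ≤ 0) ∨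
      (h = 2 * m + 1 ∧ (m : ℝ) * (w 1 + w 3 - w 0 - w 2) ≤ w 0 - w 1)) ∨
      ((h = 2 * m ∧ (m : ℝ) * (w' 1 + w' 3 - w' 0 - w' 2) ≤ 0) ∨
      (h = 2 * m + 1 ∧ (m : ℝ) * (w' 1 + w' 3 - w' 0 - w' 2) ≤ w' 0 - w' 1)) := by
    have e : ∀ i j q : ℤ, h - 1 - i = j - h + 4 * q → w' i = w j := by
      intro i j q hq
      simp only [hw, hw']
      rw [hq, ctm_per W hp]
    rcases hm with hm | hm
    · rw [e 0 3 (m - 1) (by omega), e 1 2 (m - 1) (by omega), e 2 1 (m - 1) (by omega),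
        e 3 0 (m - 1) (by omega)]
      rcases le_total ((m : ℝ) * (w 1 + w 3 - w 0 - w 2)) 0 with hc | hc
      · exact Or.inl (Or.inl ⟨hm, hc⟩)
      · exact Or.inr (Or.inl ⟨hm, by linarith⟩)
    · rw [e 0 1 m (by omega), e 1 0 m (by omega), e 2 3 (m - 1) (by omega),
        e 3 2 (m - 1) (by omega)]
      rcases le_total ((m : ℝ) * (w 1 + w 3 - w 0 - w 2)) (w 0 - w 1) with hc | hc
      · exact Or.inl (Or.inr ⟨hm, hc⟩)
      · exact Or.inr (Or.inr ⟨hm, by linarith⟩)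
  rcases key with key | key
  · obtain ⟨y, y1, y2, y3, y4, y5, y6⟩ := ctm_seqB w
      (fun s => by simp only [hw]; rw [← hp (s - h)]; congr 1; ring) (fun s => hb _) h m key
    have e0 : ∀ s : ℤ, w (s + h) = W s := fun s => by simp [hw]
    have e1 : ∀ s : ℤ, s + 1 + h = s + h + 1 := fun s => by ring
    refine ⟨0, fun s => y (s + h), ?_, ?_, ?_, ?_, ?_, ?_, ?_, ?_⟩
    · intro s hs hs2
      dsimp only
      rw [e1, ← e0]
      exact y1 _ (by omega) (by omega)
    · intro s hs hs2 hs3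
      dsimp only
      rw [e1, ← e0]
      exact y2 _ (by omega) (by omega) (by omega)
    · intro s hs hs2 hs3
      exact y3 (s + h) (by omega) (by omega) (by omega)
    · intro s hs hs2 hs3
      exact y4 (s + h) (by omega) (by omega) (by omega)
    · dsimp only
      rw [← two_mul, y6]
    · simpa using y5
    · intro _
      dsimp only
      rw [← two_mul, y6]
    · intro hh
      omega
  · obtain ⟨y, y1, y2, y3, y4, y5, y6⟩ := ctm_seqB w'
      (fun s => by simp only [hw']; rw [← hp (h - 1 - (s + 4))]; congr 1; ring)
      (fun s => hb _) h m key
    have e0 : ∀ s : ℤ, w' (h - (s + 1)) = W s := fun s => by simp only [hw']; congr 1; ring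
    have e1 : ∀ s : ℤ, h - s = h - (s + 1) + 1 := fun s => by ring
    refine ⟨1, fun s => y (h - s), ?_, ?_, ?_, ?_, ?_, ?_, ?_, ?_⟩
    · intro s hs hs2
      dsimp only
      rw [e1 s, ← e0, add_comm (y _)]
      exact y1 (h - (s + 1)) (by omega) (by omega)
    · intro s hs hs2 hs3
      dsimp only
      rw [e1 s, ← e0, add_comm (y _)]
      exact y2 (h - (s + 1)) (by omega) (by omega) (by omega)
    · intro s hs hs2 hs3
      exact y3 (h - s) (by omega) (by omega) (by omega)
    · intro s hs hs2 hs3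
      exact y4 (h - s) (by omega) (by omega) (by omega)
    · simpa using y5
    · dsimp only
      rw [sub_neg_eq_add, ← two_mul, y6]
    · intro hh
      omega
    · intro _
      dsimp only
      rw [sub_neg_eq_add, ← two_mul, y6]

/-- The other index in the same pair. -/
def ctMate {n : ℕ} (i : Fin n) : Fin n :=
  if h : (i : ℕ) % 2 = 0 ∧ (i : ℕ) + 1 < n then ⟨i + 1, h.2⟩
  else if (i : ℕ) % 2 = 1 then ⟨i - 1, by omega⟩ else i

lemma ctMate_val {n : ℕ} (i : Fin n) : (ctMate i : ℕ) =
    if (i : ℕ) % 2 = 0 ∧ (i : ℕ) + 1 < n then (i : ℕ) + 1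
    else if (i : ℕ) % 2 = 1 then (i : ℕ) - 1 else i := by
  unfold ctMate
  split_ifs <;> rfl

lemma ctMate_mate {n : ℕ} (i : Fin n) : ctMate (ctMate i) = i := by
  apply Fin.ext
  have := i.2
  rw [ctMate_val (ctMate i), ctMate_val i]
  split_ifs <;> omega

lemma ctMate_div {n : ℕ} (i : Fin n) : (ctMate i : ℕ) / 2 = (i : ℕ) / 2 := by
  rw [ctMate_val i]
  split_ifs <;> omega

lemma ctMate_ne {n : ℕ} (hn : Even n) (i : Fin n) : ctMate i ≠ i := by
  intro h
  have h2 := congrArg Fin.val h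
  have := i.2
  obtain ⟨m, hm⟩ := hn
  rw [ctMate_val i] at h2
  split_ifs at h2 <;> omega

lemma ctMate_eq {n : ℕ} (i j : Fin n) (h : (i : ℕ) / 2 = (j : ℕ) / 2) :
    j = i ∨ j = ctMate i := by
  by_cases hij : j = i
  · exact Or.inl hij
  right
  have : (j : ℕ) ≠ i := fun h => hij (Fin.ext h)
  apply Fin.ext
  have := j.2
  rw [ctMate_val i]
  split_ifs <;> omega

/-- Rotation of every heavy 4-cycle by one step. -/
def ctRot (n : ℕ) : Equiv.Perm (KnnNode n) where
  toFun := fun a => match a with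
    | Sum.inl i => Sum.inr i
    | Sum.inr i => Sum.inl (ctMate i)
  invFun := fun a => match a with
    | Sum.inr i => Sum.inl i
    | Sum.inl i => Sum.inr (ctMate i)
  left_inv := by rintro (i | i) <;> simp [ctMate_mate]
  right_inv := by rintro (i | i) <;> simp [ctMate_mate]

@[simp] lemma ctRot_inl {n : ℕ} (i : Fin n) : ctRot n (Sum.inl i) = Sum.inr i := rfl
@[simp] lemma ctRot_inr {n : ℕ} (i : Fin n) : ctRot n (Sum.inr i) = Sum.inl (ctMate i) := rfl

lemma ctRot_four (n : ℕ) : ctRot n ^ (4 : ℤ) = 1 := by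
  ext1 a
  have : ctRot n ^ (4 : ℤ) = ctRot n * ctRot n * ctRot n * ctRot n := by
    rw [show (4 : ℤ) = ((4 : ℕ) : ℤ) from rfl, zpow_natCast]; simp [pow_succ]
  rw [this]
  rcases a with i | i <;> simp [ctMate_mate]

lemma ctRot_adj {n : ℕ} (a : KnnNode n) : KnnAdj a (ctRot n a) := by
  rcases a with i | i <;> simp [KnnAdj]

lemma ctRot_two_ne {n : ℕ} (hn : Even n) (a : KnnNode n) : ctRot n (ctRot n a) ≠ a := by
  rcases a with i | i <;> simp [ctMate_ne hn]

lemma KnnAdj.flip {n : ℕ} {a b : KnnNode n} (h : KnnAdj a b) : KnnAdj b a := Ne.symm h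

lemma nodeWeight_comm {n : ℕ} (w : Fin n → Fin n → ℝ) (a b : KnnNode n) :
    nodeWeight w a b = nodeWeight w b a := by
  rcases a with i | i <;> rcases b with j | j <;> rfl

lemma ctRot_not_light {n : ℕ} (a : KnnNode n) : ¬ IsLightPair a (ctRot n a) := by
  rintro ⟨i, j, (⟨rfl, h⟩ | ⟨rfl, h⟩), hij⟩
  · simp at h; subst h; exact hij rfl
  · simp at h; subst h; exact hij (ctMate_div _)

lemma IsLightPair.flip {n : ℕ} {a b : KnnNode n} (h : IsLightPair a b) : IsLightPair b a := by
  obtain ⟨i, j, h, hij⟩ := h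
  exact ⟨i, j, by tauto, hij⟩

lemma ctRot_of_heavy {n : ℕ} {a b : KnnNode n} (h : KnnAdj a b) (hl : ¬ IsLightPair a b) :
    b = ctRot n a ∨ a = ctRot n b := by
  rcases a with i | i <;> rcases b with j | j
  · simp [KnnAdj] at h
  · have : (i : ℕ) / 2 = (j : ℕ) / 2 := by
      by_contra hc
      exact hl ⟨i, j, Or.inl ⟨rfl, rfl⟩, hc⟩
    rcases ctMate_eq i j this with rfl | rfl
    · left; simp
    · right; simp [ctMate_mate]
  · have : (i : ℕ) / 2 = (j : ℕ) / 2 := by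
      by_contra hc
      exact hl ⟨j, i, Or.inr ⟨rfl, rfl⟩, fun h => hc h.symm⟩
    rcases ctMate_eq i j this with rfl | rfl
    · right; simp
    · left; simp
  · simp [KnnAdj] at h

lemma ctRot_weight {n : ℕ} (w : Fin n → Fin n → ℝ) (P : ℝ → Prop)
    (hw : ∀ i j : Fin n, (i : ℕ) / 2 = (j : ℕ) / 2 → P (w i j)) (a : KnnNode n) :
    P (nodeWeight w a (ctRot n a)) := by
  rcases a with i | i
  · exact hw i i rfl
  · exact hw (ctMate i) i (ctMate_div i)

lemma light_weight {n : ℕ} (w : Fin n → Fin n → ℝ) (P : ℝ → Prop)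
    (hw : ∀ i j : Fin n, (i : ℕ) / 2 ≠ (j : ℕ) / 2 → P (w i j)) (a b : KnnNode n)
    (h : IsLightPair a b) : P (nodeWeight w a b) := by
  obtain ⟨i, j, (⟨rfl, rfl⟩ | ⟨rfl, rfl⟩), hij⟩ := h
  · exact hw i j hij
  · exact hw i j hij

/-- The label of a walk. -/
def ctLab {n : ℕ} (x : KnnNode n) (L : List (KnnNode n)) : KnnNode n := L.getLast?.getD x

@[simp] lemma ctLab_snoc {n : ℕ} (x : KnnNode n) (L : List (KnnNode n)) (b : KnnNode n) :
    ctLab x (L ++ [b]) = b := by simp [ctLab]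

lemma ctLab_get {n : ℕ} (x : KnnNode n) (L : List (KnnNode n)) (hL : L ≠ []) :
    L.getLast? = some (ctLab x L) := by
  obtain ⟨M, b, rfl⟩ := List.eq_nil_or_concat' L |>.resolve_left hL
  simp

lemma ctEdgeWeight_snoc {n : ℕ} (w : Fin n → Fin n → ℝ) (x : KnnNode n)
    (M : List (KnnNode n)) (b : KnnNode n) (hM : M ≠ []) :
    ctEdgeWeight w (M ++ [b]) = nodeWeight w (ctLab x M) b := by
  unfold ctEdgeWeight
  simp [ctLab_get x M hM]

/-- Signed position (on reversed walks) within the heavy path. -/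
def ctPosR {n : ℕ} : List (KnnNode n) → ℤ
  | b :: a :: r => if b = ctRot n a then ctPosR (a :: r) + 1
      else if a = ctRot n b then ctPosR (a :: r) - 1 else 0
  | _ => 0

def ctPos {n : ℕ} (L : List (KnnNode n)) : ℤ := ctPosR L.reverse

lemma ctPos_snoc {n : ℕ} (x : KnnNode n) (M : List (KnnNode n)) (b : KnnNode n) (hM : M ≠ []) :
    ctPos (M ++ [b]) = if b = ctRot n (ctLab x M) then ctPos M + 1
      else if ctLab x M = ctRot n b then ctPos M - 1 else 0 := by
  obtain ⟨N, a, rfl⟩ := List.eq_nil_or_concat' M |>.resolve_left hM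
  simp [ctPos, ctPosR]

lemma ctPos_single {n : ℕ} (a : KnnNode n) : ctPos [a] = 0 := by
  simp [ctPos, ctPosR]

lemma ctPos_nil {n : ℕ} : ctPos ([] : List (KnnNode n)) = 0 := by
  simp [ctPos, ctPosR]

lemma ctv_parent {n k : ℕ} {x : KnnNode n} {M : List (KnnNode n)} {b : KnnNode n} (hM : M ≠ [])
    (h : IsCTVertex n k x (M ++ [b])) : IsCTVertex n k x M ∧ M.length ≤ k + 1 := by
  obtain ⟨h1, h2, h3, h4, h5⟩ := h
  simp at h2
  have key : ∀ (i : ℕ) (a : KnnNode n), M[i]? = some a → (M ++ [b])[i]? = some a := by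
    intro i a hi
    have : i < M.length := by
      by_contra hc
      simp [List.getElem?_eq_none (not_lt.mp hc)] at hi
    rw [List.getElem?_append_left this, hi]
  refine ⟨⟨hM, by omega, ?_, ?_, ?_⟩, by omega⟩
  · rw [List.head?_append_of_ne_nil _ hM] at h3
    exact h3
  · intro i a c ha hc
    exact h4 i a c (key _ _ ha) (key _ _ hc)
  · intro i a c ha hc
    exact h5 i a c (key _ _ ha) (key _ _ hc)

lemma ctv_adj {n k : ℕ} {x : KnnNode n} {M : List (KnnNode n)} {b : KnnNode n} (hM : M ≠ [])
    (h : IsCTVertex n k x (M ++ [b])) : KnnAdj (ctLab x M) b := by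
  obtain ⟨N, a, rfl⟩ := List.eq_nil_or_concat' M |>.resolve_left hM
  obtain ⟨h1, h2, h3, h4, h5⟩ := h
  rw [ctLab_snoc]
  apply h4 N.length
  · simp
  · simp

lemma ctv_nonback {n k : ℕ} {x : KnnNode n} {M : List (KnnNode n)} {a b : KnnNode n} (hM : M ≠ [])
    (h : IsCTVertex n k x (M ++ [a] ++ [b])) : ctLab x M ≠ b := by
  obtain ⟨N, c, rfl⟩ := List.eq_nil_or_concat' M |>.resolve_left hM
  obtain ⟨h1, h2, h3, h4, h5⟩ := h
  rw [ctLab_snoc]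
  apply h5 N.length
  · simp
  · simp

lemma ctv_extend {n k : ℕ} {x : KnnNode n} {M : List (KnnNode n)} {b : KnnNode n}
    (h : IsCTVertex n k x M) (hl : M.length ≤ k + 1) (hadj : KnnAdj (ctLab x M) b)
    (hnb : ∀ N a, N ≠ [] → M = N ++ [a] → ctLab x N ≠ b) : IsCTVertex n k x (M ++ [b]) := by
  obtain ⟨h1, h2, h3, h4, h5⟩ := h
  refine ⟨by simp, by simp; omega, ?_, ?_, ?_⟩
  · rw [List.head?_append_of_ne_nil _ h1]; exact h3
  · intro i a c ha hc
    have hi : i + 1 < M.length + 1 := by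
      by_contra hcon
      rw [List.getElem?_eq_none (by simp; omega)] at hc
      simp at hc
    rw [List.getElem?_append_left (by omega)] at ha
    by_cases hi2 : i + 1 < M.length
    · rw [List.getElem?_append_left hi2] at hc
      exact h4 i a c ha hc
    · have hi3 : i + 1 = M.length := by omega
      rw [hi3] at hc
      simp at hc
      subst hc
      have : ctLab x M = a := by
        unfold ctLab
        rw [List.getLast?_eq_getElem?, ← hi3]
        simp [ha]
      rwa [this] at hadj
  · intro i a c ha hc
    have hi : i + 2 < M.length + 1 := by
      by_contra hcon
      rw [List.getElem?_eq_none (by simp; omega)] at hc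
      simp at hc
    rw [List.getElem?_append_left (by omega)] at ha
    by_cases hi2 : i + 2 < M.length
    · rw [List.getElem?_append_left hi2] at hc
      exact h5 i a c ha hc
    · have hi3 : i + 2 = M.length := by omega
      rw [hi3] at hc
      simp at hc
      subst hc
      obtain ⟨N, d, rfl⟩ := List.eq_nil_or_concat' M |>.resolve_left h1
      simp at hi3
      have hN : N ≠ [] := by rintro rfl; simp at hi3
      have := hnb N d hN rfl
      rw [List.getElem?_append_left (by omega)] at ha
      have e : ctLab x N = a := by
        unfold ctLab
        rw [List.getLast?_eq_getElem?, ← hi3]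
        simp [ha]
      rwa [e] at this

lemma ctPos_of_ct {n k : ℕ} {x : KnnNode n} {L : List (KnnNode n)} (h : IsCTVertex n k x L)
    (hp : ctPos L ≠ 0) : ∃ M b, M ≠ [] ∧ L = M ++ [b] := by
  obtain ⟨M, b, rfl⟩ := List.eq_nil_or_concat' L |>.resolve_left h.1
  refine ⟨M, b, ?_, rfl⟩
  rintro rfl
  exact hp (ctPos_single b)

/-- Trichotomy for tree edges. -/
lemma ct_edge {n k : ℕ} {x : KnnNode n} : ∀ (M : List (KnnNode n)) (b : KnnNode n),
    M ≠ [] → IsCTVertex n k x (M ++ [b]) →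
    (0 ≤ ctPos M ∧ ctPos (M ++ [b]) = ctPos M + 1 ∧ b = ctRot n (ctLab x M)) ∨
    (ctPos M ≤ 0 ∧ ctPos (M ++ [b]) = ctPos M - 1 ∧ ctLab x M = ctRot n b) ∨
    (ctPos (M ++ [b]) = 0 ∧ IsLightPair (ctLab x M) b) := by
  intro M
  induction M using List.reverseRecOn with
  | nil => intro b h; exact absurd rfl h
  | append_singleton N a ih =>
    intro b hM h
    have hadj := ctv_adj hM h
    rw [ctPos_snoc x _ _ hM]
    simp only [ctLab_snoc] at hadj ⊢
    have hsign : N ≠ [] → _ := fun hN => ih a hN (ctv_parent hM h).1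
    have hnb : N ≠ [] → ctLab x N ≠ b := fun hN => ctv_nonback hN h
    have h0 : N = [] → ctPos (N ++ [a]) = 0 := by rintro rfl; exact ctPos_single a
    by_cases hb : b = ctRot n a
    · left
      refine ⟨?_, by simp [hb], hb⟩
      by_cases hN : N = []
      · exact (h0 hN).ge
      · rcases hsign hN with hs | hs | hs
        · omega
        · exact absurd (hs.2.2.trans hb.symm) (hnb hN)
        · exact hs.1.ge
    · rw [if_neg hb]
      by_cases hb' : a = ctRot n b
      · right; left
        refine ⟨?_, by simp [hb'], hb'⟩
        by_cases hN : N = []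
        · exact (h0 hN).le
        · rcases hsign hN with hs | hs | hs
          · have : ctRot n b = ctRot n (ctLab x N) := hb'.symm.trans hs.2.2
            exact absurd ((ctRot n).injective this).symm (hnb hN)
          · omega
          · exact hs.1.le
      · right; right
        refine ⟨by simp [hb'], ?_⟩
        by_contra hc
        rcases ctRot_of_heavy hadj hc with h | h
        · exact hb h
        · exact hb' h

/-- Height of the heavy path through `L`. -/
def ctHt {n : ℕ} (k : ℕ) (L : List (KnnNode n)) : ℕ := k + 2 - L.length + (ctPos L).natAbs

/-- Label of the top vertex of the heavy path through `L`. -/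
def ctBase {n : ℕ} (x : KnnNode n) (L : List (KnnNode n)) : KnnNode n :=
  (ctRot n ^ (-(ctPos L))) (ctLab x L)

lemma ctBase_lab {n : ℕ} (x : KnnNode n) (L : List (KnnNode n)) :
    (ctRot n ^ (ctPos L)) (ctBase x L) = ctLab x L := by
  rw [ctBase, ← Equiv.Perm.mul_apply, ← zpow_add]; simp

lemma ct_heavy_up {n k : ℕ} {x : KnnNode n} {M : List (KnnNode n)} {b : KnnNode n}
    (hl : M.length ≤ k + 1) (h0 : 0 ≤ ctPos M)
    (hp : ctPos (M ++ [b]) = ctPos M + 1) (hb : b = ctRot n (ctLab x M)) :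
    ctHt k (M ++ [b]) = ctHt k M ∧ ctBase x (M ++ [b]) = ctBase x M := by
  constructor
  · simp only [ctHt, hp, List.length_append, List.length_singleton]
    omega
  · unfold ctBase
    rw [hp, ctLab_snoc]
    have : ctRot n ^ (-(ctPos M)) = ctRot n ^ (-(ctPos M + 1)) * ctRot n := by
      rw [← zpow_add_one]; congr 1; ring
    rw [this, Equiv.Perm.mul_apply, ← hb]

lemma ct_heavy_down {n k : ℕ} {x : KnnNode n} {M : List (KnnNode n)} {b : KnnNode n}
    (hl : M.length ≤ k + 1) (h0 : ctPos M ≤ 0)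
    (hp : ctPos (M ++ [b]) = ctPos M - 1) (hb : ctLab x M = ctRot n b) :
    ctHt k (M ++ [b]) = ctHt k M ∧ ctBase x (M ++ [b]) = ctBase x M := by
  constructor
  · simp only [ctHt, hp, List.length_append, List.length_singleton]
    omega
  · unfold ctBase
    rw [hp, ctLab_snoc, hb]
    have : ctRot n ^ (-(ctPos M - 1)) = ctRot n ^ (-(ctPos M)) * ctRot n := by
      rw [← zpow_add_one]; congr 1; ring
    rw [this, Equiv.Perm.mul_apply]

/-- Selected heavy edges. -/
def ctSel {n : ℕ} (E : KnnNode n → ℕ → ℤ) (k : ℕ) (x : KnnNode n) (L : List (KnnNode n)) : Prop :=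
  (0 < ctPos L ∧ (ctPos L - 1 + ctHt k L + E (ctBase x L) (ctHt k L)) % 2 = 0) ∨
  (ctPos L < 0 ∧ (ctPos L + ctHt k L + E (ctBase x L) (ctHt k L)) % 2 = 0)

lemma ct_two_le {n k : ℕ} {x : KnnNode n} {L : List (KnnNode n)} (h : IsCTVertex n k x L)
    (hp : ctPos L ≠ 0) : 2 ≤ L.length := by
  obtain ⟨M, b, hM, rfl⟩ := ctPos_of_ct h hp
  have := List.length_pos_iff.mpr hM
  simp; omega

lemma ct_split {n : ℕ} {L : List (KnnNode n)} (h : 2 ≤ L.length) :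
    ∃ M b, M ≠ [] ∧ L = M ++ [b] := by
  obtain ⟨M, b, rfl⟩ := List.eq_nil_or_concat' L |>.resolve_left (by rintro rfl; simp at h)
  refine ⟨M, b, ?_, rfl⟩
  rintro rfl
  simp at h

lemma ct_sel_matching {n k : ℕ} (hn : Even n) (E : KnnNode n → ℕ → ℤ) (x : KnnNode n)
    (Λ : Finset (List (KnnNode n)))
    (hΛ : ∀ L, L ∈ Λ ↔ IsCTVertex n k x L ∧ ctSel E k x L) : IsTMatching n k x Λ := by
  have h1 : ∀ L ∈ Λ, IsCTVertex n k x L ∧ 2 ≤ L.length := by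
    intro L hL
    obtain ⟨hv, hs⟩ := (hΛ L).1 hL
    refine ⟨hv, ct_two_le hv ?_⟩
    rcases hs with h | h <;> omega
  have h3 : ∀ L : List (KnnNode n), IsCTVertex n k x L → L.length ≤ k + 1 →
      ∃! L', L' ∈ Λ ∧ (L' = L ∨ L'.dropLast = L) := by
    intro L hv hl
    -- selected children of `L`
    have hchild : ∀ L' ∈ Λ, L'.dropLast = L →
        (0 ≤ ctPos L ∧ L' = L ++ [ctRot n (ctLab x L)] ∧
          (ctPos L + ctHt k L + E (ctBase x L) (ctHt k L)) % 2 = 0) ∨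
        (ctPos L ≤ 0 ∧ L' = L ++ [(ctRot n).symm (ctLab x L)] ∧
          (ctPos L - 1 + ctHt k L + E (ctBase x L) (ctHt k L)) % 2 = 0) := by
      intro L' hL' hd
      obtain ⟨M, b, hM, rfl⟩ := ct_split (h1 _ hL').2
      simp at hd
      subst hd
      obtain ⟨hv', hs⟩ := (hΛ _).1 hL'
      rcases ct_edge M b hM hv' with ⟨e1, e2, e3⟩ | ⟨e1, e2, e3⟩ | ⟨e1, e2⟩
      · obtain ⟨f1, f2⟩ := ct_heavy_up hl e1 e2 e3
        left
        refine ⟨e1, by rw [← e3], ?_⟩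
        unfold ctSel at hs
        rw [f1, f2, e2] at hs
        rcases hs with ⟨g1, g2⟩ | ⟨g1, g2⟩
        · rwa [add_sub_cancel_right] at g2
        · omega
      · obtain ⟨f1, f2⟩ := ct_heavy_down hl e1 e2 e3
        right
        refine ⟨e1, by rw [e3]; simp, ?_⟩
        unfold ctSel at hs
        rw [f1, f2, e2] at hs
        rcases hs with ⟨g1, g2⟩ | ⟨g1, g2⟩
        · omega
        · exact g2
      · unfold ctSel at hs
        rw [e1] at hs
        simp at hs
    have hself : L ∈ Λ → ctSel E k x L := fun h => ((hΛ L).1 h).2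
    by_cases hpar : (ctPos L + ctHt k L + E (ctBase x L) (ctHt k L)) % 2 = 0
    · by_cases hs : ctPos L < 0
      · refine ⟨L, ⟨(hΛ L).2 ⟨hv, Or.inr ⟨hs, hpar⟩⟩, Or.inl rfl⟩, ?_⟩
        rintro L' ⟨hL', rfl | hd⟩
        · rfl
        · rcases hchild L' hL' hd with h | h <;> omega
      · push Not at hs
        have hnew : IsCTVertex n k x (L ++ [ctRot n (ctLab x L)]) := by
          refine ctv_extend hv hl (ctRot_adj _) ?_
          rintro N a hN rfl heq
          rw [ctLab_snoc] at heq
          rcases ct_edge N a hN hv with ⟨e1, e2, e3⟩ | ⟨e1, e2, e3⟩ | ⟨e1, e2⟩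
          · rw [heq] at e3
            exact ctRot_two_ne hn a e3.symm
          · omega
          · rw [heq] at e2
            exact ctRot_not_light _ e2.flip
        have hpos : ctPos (L ++ [ctRot n (ctLab x L)]) = ctPos L + 1 := by
          rw [ctPos_snoc x _ _ hv.1, if_pos rfl]
        obtain ⟨f1, f2⟩ := ct_heavy_up hl hs hpos rfl
        refine ⟨_, ⟨(hΛ _).2 ⟨hnew, Or.inl ⟨by omega, ?_⟩⟩, Or.inr (by simp)⟩, ?_⟩
        · rw [f1, f2, hpos, add_sub_cancel_right]; exact hpar
        · rintro L' ⟨hL', rfl | hd⟩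
          · rcases hself hL' with h | h <;> omega
          · rcases hchild L' hL' hd with h | h
            · exact h.2.1
            · omega
    · by_cases hs : 0 < ctPos L
      · refine ⟨L, ⟨(hΛ L).2 ⟨hv, Or.inl ⟨hs, by omega⟩⟩, Or.inl rfl⟩, ?_⟩
        rintro L' ⟨hL', rfl | hd⟩
        · rfl
        · rcases hchild L' hL' hd with h | h <;> omega
      · push Not at hs
        set b := (ctRot n).symm (ctLab x L) with hbdef
        have hb : ctLab x L = ctRot n b := by simp [hbdef]
        have hnew : IsCTVertex n k x (L ++ [b]) := by
          refine ctv_extend hv hl ?_ ?_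
          · rw [hb]; exact (ctRot_adj _).flip
          rintro N a hN rfl heq
          rw [ctLab_snoc] at hb
          rcases ct_edge N a hN hv with ⟨e1, e2, e3⟩ | ⟨e1, e2, e3⟩ | ⟨e1, e2⟩
          · omega
          · rw [heq, hb] at e3
            exact ctRot_two_ne hn b e3.symm
          · rw [heq, hb] at e2
            exact ctRot_not_light _ e2
        have hpos : ctPos (L ++ [b]) = ctPos L - 1 := by
          rw [ctPos_snoc x _ _ hv.1, if_neg, if_pos hb]
          intro hc
          rw [hb] at hc
          exact ctRot_two_ne hn b hc.symm
        obtain ⟨f1, f2⟩ := ct_heavy_down hl hs hpos hb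
        refine ⟨_, ⟨(hΛ _).2 ⟨hnew, Or.inr ⟨by omega, ?_⟩⟩, Or.inr (by simp)⟩, ?_⟩
        · rw [f1, f2, hpos]; omega
        · rintro L' ⟨hL', rfl | hd⟩
          · rcases hself hL' with h | h <;> omega
          · rcases hchild L' hL' hd with h | h
            · omega
            · exact h.2.1
  refine ⟨h1, ?_, h3⟩
  have hpar : ∀ L ∈ Λ, IsCTVertex n k x L.dropLast ∧ L.dropLast.length ≤ k + 1 := by
    intro L hL
    obtain ⟨hv, hlen⟩ := h1 L hL
    obtain ⟨M, b, hM, rfl⟩ := ct_split hlen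
    simpa using ctv_parent hM hv
  intro L₁ hL₁ L₂ hL₂ hne hor
  rcases hor with h | h | h
  · obtain ⟨hv, hl⟩ := hpar L₁ hL₁
    exact hne ((h3 _ hv hl).unique ⟨hL₁, Or.inr rfl⟩ ⟨hL₂, Or.inr h.symm⟩)
  · obtain ⟨hv, hl⟩ := hpar L₁ hL₁
    exact hne ((h3 _ hv hl).unique ⟨hL₁, Or.inr rfl⟩ ⟨hL₂, Or.inl h.symm⟩)
  · obtain ⟨hv, hl⟩ := hpar L₂ hL₂
    exact hne ((h3 _ hv hl).unique ⟨hL₁, Or.inl h⟩ ⟨hL₂, Or.inr rfl⟩)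

lemma ct_finite (n k : ℕ) (x : KnnNode n) : {L | IsCTVertex n k x L}.Finite :=
  (List.finite_length_le (KnnNode n) (k + 2)).subset fun _ h => h.2.1

/-- The potentials summed over a matching. -/
lemma ct_sum_cov {n k : ℕ} {x : KnnNode n} {Λ : Finset (List (KnnNode n))}
    (h : IsTMatching n k x Λ) (y : List (KnnNode n) → ℝ) :
    ∑ L ∈ Λ, (y L.dropLast + y L) = ∑ L ∈ Λ ∪ Λ.image List.dropLast, y L := by
  obtain ⟨h1, h2, h3⟩ := h
  rw [Finset.sum_union, Finset.sum_image, ← Finset.sum_add_distrib]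
  · exact Finset.sum_congr rfl fun _ _ => add_comm _ _
  · intro L₁ hL₁ L₂ hL₂ heq
    by_contra hne
    exact h2 L₁ hL₁ L₂ hL₂ hne (Or.inl heq)
  · rw [Finset.disjoint_left]
    intro L hL hL'
    obtain ⟨L', hL'm, heq⟩ := Finset.mem_image.1 hL'
    by_cases hne : L = L'
    · subst hne
      have := (h1 L hL).2
      have e := congrArg List.length heq
      simp at e
      omega
    · exact h2 L hL L' hL'm hne (Or.inr (Or.inr heq.symm))

lemma ct_cov_subset {n k : ℕ} {x : KnnNode n} {Λ : Finset (List (KnnNode n))}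
    (h : IsTMatching n k x Λ) :
    Λ ∪ Λ.image List.dropLast ⊆ (ct_finite n k x).toFinset := by
  intro L hL
  rw [Set.Finite.mem_toFinset]
  rcases Finset.mem_union.1 hL with hL | hL
  · exact (h.1 L hL).1
  · obtain ⟨L', hL', rfl⟩ := Finset.mem_image.1 hL
    obtain ⟨hv, hlen⟩ := h.1 L' hL'
    obtain ⟨M, b, hM, rfl⟩ := ct_split hlen
    simpa using (ctv_parent hM hv).1

lemma ct_uncov {n k : ℕ} {x : KnnNode n} {Λ : Finset (List (KnnNode n))}
    (h : IsTMatching n k x Λ) (L : List (KnnNode n)) (hv : IsCTVertex n k x L)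
    (hL : L ∉ Λ ∪ Λ.image List.dropLast) : L.length = k + 2 := by
  by_contra hc
  have := hv.2.1
  obtain ⟨L', ⟨hL', hor⟩, -⟩ := h.2.2 L hv (by omega)
  apply hL
  rcases hor with rfl | rfl
  · exact Finset.mem_union_left _ hL'
  · exact Finset.mem_union_right _ (Finset.mem_image_of_mem _ hL')

/-- **Maximum-weight `T`-matchings avoid light edges.** Let `φ ≥ 26`, let `n ≥ 2` be
even, and let the weights of `K_{n,n}` be such that every heavy edge (inside a group)
has weight in `[20/26 - 1/φ, 1]` and every light edge (between groups) has weight in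
`[0, 1/φ]`. Then for every node `x`, every level `k ≥ 0` and every maximum-weight
`T`-matching `Λ*` of the computation tree `T^k(x)`, `Λ*` contains no light edge. -/
theorem max_T_matching_no_light_edges
    (φ : ℝ) (hφ : 26 ≤ φ) (n : ℕ) (hn2 : 2 ≤ n) (hneven : Even n)
    (w : Fin n → Fin n → ℝ)
    (hheavy : ∀ i j : Fin n, (i : ℕ) / 2 = (j : ℕ) / 2 →
      w i j ∈ Set.Icc (20 / 26 - 1 / φ) 1)
    (hlight : ∀ i j : Fin n, (i : ℕ) / 2 ≠ (j : ℕ) / 2 →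
      w i j ∈ Set.Icc (0 : ℝ) (1 / φ))
    (x : KnnNode n) (k : ℕ) (Λ : Finset (List (KnnNode n)))
    (hΛ : IsTMatching n k x Λ)
    (hmax : ∀ Λ' : Finset (List (KnnNode n)), IsTMatching n k x Λ' →
      tMatchingWeight w Λ' ≤ tMatchingWeight w Λ) :
    ∀ L ∈ Λ, ∀ a b : KnnNode n,
      L.dropLast.getLast? = some a → L.getLast? = some b → ¬ IsLightPair a b := by
  intro L₀ hL₀ a₀ b₀ ha₀ hb₀ hlt
  have hφ1 : 1 / φ ≤ 1 / 26 := one_div_le_one_div_of_le (by norm_num) hφ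
  set W : KnnNode n → ℤ → ℝ := fun t s =>
    nodeWeight w ((ctRot n ^ s) t) ((ctRot n ^ (s + 1)) t) with hW
  have hstep : ∀ (t : KnnNode n) (s : ℤ),
      (ctRot n ^ (s + 1)) t = ctRot n ((ctRot n ^ s) t) := by
    intro t s
    rw [add_comm, zpow_add, zpow_one, Equiv.Perm.mul_apply]
  have hWp : ∀ t s, W t (s + 4) = W t s := by
    intro t s
    have e1 : ctRot n ^ (s + 4) = ctRot n ^ s := by
      rw [zpow_add, ctRot_four, mul_one]
    have e2 : ctRot n ^ (s + 4 + 1) = ctRot n ^ (s + 1) := by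
      rw [zpow_add, e1, ← zpow_add]
    simp only [hW, e1, e2]
  have hWb : ∀ t s, 19/26 ≤ W t s ∧ W t s ≤ 1 := by
    intro t s
    simp only [hW]
    rw [hstep]
    refine ctRot_weight w (fun r => 19/26 ≤ r ∧ r ≤ 1) ?_ _
    intro i j hij
    have := hheavy i j hij
    exact ⟨by linarith [this.1], this.2⟩
  choose E Y y1 y2 y3 y4 y5 y6 y7 y8 using fun t h => ctm_seq (W t) (hWp t) (hWb t) h
  set y : List (KnnNode n) → ℝ := fun L => Y (ctBase x L) (ctHt k L) (ctPos L) with hy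
  have hbound : ∀ L : List (KnnNode n), -(ctHt k L : ℤ) ≤ ctPos L ∧ ctPos L ≤ ctHt k L := by
    intro L
    simp only [ctHt]
    constructor <;> omega
  -- facts about tree edges
  have hedge : ∀ L, IsCTVertex n k x L → 2 ≤ L.length →
      ctEdgeWeight w L ≤ y L.dropLast + y L ∧
      (ctSel E k x L → ctEdgeWeight w L = y L.dropLast + y L) ∧
      (∀ a b, L.dropLast.getLast? = some a → L.getLast? = some b → IsLightPair a b →
        ctEdgeWeight w L < y L.dropLast + y L) := by
    intro L hv hlen
    obtain ⟨M, b, hM, rfl⟩ := ct_split hlen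
    obtain ⟨hvM, hlM⟩ := ctv_parent hM hv
    rw [ctEdgeWeight_snoc w x M b hM]
    simp only [List.dropLast_concat, List.getLast?_concat, ctLab_get x M hM, Option.some.injEq]
    have hbM := hbound M
    have hbL := hbound (M ++ [b])
    rcases ct_edge M b hM hv with ⟨e1, e2, e3⟩ | ⟨e1, e2, e3⟩ | ⟨e1, e2⟩
    · obtain ⟨f1, f2⟩ := ct_heavy_up hlM e1 e2 e3
      have hw : nodeWeight w (ctLab x M) b = W (ctBase x M) (ctPos M) := by
        simp only [hW]
        rw [hstep, ctBase_lab, ← e3]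
      have hyL : y (M ++ [b]) = Y (ctBase x M) (ctHt k M) (ctPos M + 1) := by
        simp only [hy, f1, f2, e2]
      rw [hw, hyL]
      rw [f1, e2] at hbL
      refine ⟨y1 _ _ _ hbM.1 (by omega), ?_, ?_⟩
      · intro hs
        apply y2 _ _ _ hbM.1 (by omega)
        unfold ctSel at hs
        rw [f1, f2, e2] at hs
        rcases hs with ⟨g1, g2⟩ | ⟨g1, g2⟩
        · rwa [add_sub_cancel_right] at g2
        · omega
      · rintro a' b' rfl rfl hl
        rw [e3] at hl
        exact absurd hl (ctRot_not_light _)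
    · obtain ⟨f1, f2⟩ := ct_heavy_down hlM e1 e2 e3
      have hw : nodeWeight w (ctLab x M) b = W (ctBase x M) (ctPos M - 1) := by
        have g1 : (ctRot n ^ (ctPos M - 1)) (ctBase x M) = b := by
          have := ctBase_lab x (M ++ [b])
          rwa [f2, e2, ctLab_snoc] at this
        simp only [hW]
        rw [hstep, g1, nodeWeight_comm, e3]
      have hyL : y (M ++ [b]) = Y (ctBase x M) (ctHt k M) (ctPos M - 1) := by
        simp only [hy, f1, f2, e2]
      have hyM : y M = Y (ctBase x M) (ctHt k M) (ctPos M - 1 + 1) := by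
        simp only [hy, sub_add_cancel]
      rw [hw, hyL, hyM, add_comm]
      rw [f1, e2] at hbL
      refine ⟨y1 _ _ _ hbL.1 (by omega), ?_, ?_⟩
      · intro hs
        apply y2 _ _ _ hbL.1 (by omega)
        unfold ctSel at hs
        rw [f1, f2, e2] at hs
        rcases hs with ⟨g1, g2⟩ | ⟨g1, g2⟩
        · omega
        · exact g2
      · rintro a' b' rfl rfl hl
        rw [e3] at hl
        exact absurd hl.flip (ctRot_not_light _)
    · have hlw : nodeWeight w (ctLab x M) b ≤ 1 / 26 :=
        light_weight w (fun r => r ≤ 1 / 26) (fun i j hij => (hlight i j hij).2.trans hφ1) _ _ e2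
      have hsum : 5 / 26 ≤ y M + y (M ++ [b]) := by
        have g1 : (ctPos M + ctHt k M) % 2 = ((k : ℤ) + 2 - M.length) % 2 := by
          simp only [ctHt]; omega
        have g2 : (ctPos (M ++ [b]) + ctHt k (M ++ [b])) % 2 = ((k : ℤ) + 1 - M.length) % 2 := by
          simp only [ctHt]; simp only [List.length_append, List.length_singleton]; omega
        rcases Int.emod_two_eq_zero_or_one (ctPos M + ctHt k M) with hp | hp
        · have h1 := y3 (ctBase x M) _ _ hbM.1 hbM.2 hp
          have h2 := y4 (ctBase x (M ++ [b])) _ _ hbL.1 hbL.2 (by omega)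
          simp only [hy]
          linarith
        · have h1 := y4 (ctBase x M) _ _ hbM.1 hbM.2 hp
          have h2 := y3 (ctBase x (M ++ [b])) _ _ hbL.1 hbL.2 (by omega)
          simp only [hy]
          linarith
      refine ⟨by linarith, ?_, fun _ _ _ _ _ => by linarith⟩
      intro hs
      unfold ctSel at hs
      rw [e1] at hs
      simp at hs
  -- the competitor
  classical
  set Λ' : Finset (List (KnnNode n)) :=
    (ct_finite n k x).toFinset.filter (fun L => ctSel E k x L) with hΛ'
  have hmem : ∀ L, L ∈ Λ' ↔ IsCTVertex n k x L ∧ ctSel E k x L := by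
    intro L
    simp [hΛ']
  have hT' : IsTMatching n k x Λ' := ct_sel_matching hneven E x Λ' hmem
  have hleaf : ∀ L, IsCTVertex n k x L → L.length = k + 2 →
      0 ≤ y L ∧ (¬ ctSel E k x L → y L = 0) := by
    intro L hv hlen
    have hh : ctHt k L = (ctPos L).natAbs := by simp [ctHt, hlen]
    rcases le_total 0 (ctPos L) with hp | hp
    · have e : ctPos L = ctHt k L := by omega
      have ey : y L = Y (ctBase x L) (ctHt k L) (ctHt k L) := by
        simp only [hy]; rw [← e]
      refine ⟨ey ▸ y5 _ _, fun hs => ?_⟩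
      by_cases h0 : ctPos L = 0
      · have hh0 : ctHt k L = 0 := by omega
        rw [ey]
        rcases Int.emod_two_eq_zero_or_one (E (ctBase x L) (ctHt k L)) with hE | hE
        · exact y7 _ _ hE
        · have := y8 _ _ hE
          rw [hh0] at this ⊢
          simpa using this
      · rw [ey]
        apply y7
        by_contra hE
        exact hs (Or.inl ⟨by omega, by omega⟩)
    · have e : ctPos L = -ctHt k L := by omega
      have ey : y L = Y (ctBase x L) (ctHt k L) (-ctHt k L) := by
        simp only [hy]; rw [← e]
      refine ⟨ey ▸ y6 _ _, fun hs => ?_⟩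
      by_cases h0 : ctPos L = 0
      · have hh0 : ctHt k L = 0 := by omega
        rw [ey]
        rcases Int.emod_two_eq_zero_or_one (E (ctBase x L) (ctHt k L)) with hE | hE
        · have := y7 _ _ hE
          rw [hh0] at this ⊢
          simpa using this
        · exact y8 _ _ hE
      · rw [ey]
        apply y8
        by_contra hE
        exact hs (Or.inr ⟨by omega, by omega⟩)
  have hlt1 : tMatchingWeight w Λ < ∑ L ∈ Λ, (y L.dropLast + y L) := by
    refine Finset.sum_lt_sum (fun L hL => (hedge L (hΛ.1 L hL).1 (hΛ.1 L hL).2).1) ?_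
    exact ⟨L₀, hL₀, (hedge L₀ (hΛ.1 L₀ hL₀).1 (hΛ.1 L₀ hL₀).2).2.2 a₀ b₀ ha₀ hb₀ hlt⟩
  have hle : ∑ L ∈ Λ, (y L.dropLast + y L) ≤ ∑ L ∈ (ct_finite n k x).toFinset, y L := by
    rw [ct_sum_cov hΛ y]
    refine Finset.sum_le_sum_of_subset_of_nonneg (ct_cov_subset hΛ) ?_
    intro L hL hL'
    have hv : IsCTVertex n k x L := by simpa using hL
    exact (hleaf L hv (ct_uncov hΛ L hv hL')).1
  have heq : ∑ L ∈ Λ', (y L.dropLast + y L) = ∑ L ∈ (ct_finite n k x).toFinset, y L := by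
    rw [ct_sum_cov hT' y]
    refine Finset.sum_subset (ct_cov_subset hT') ?_
    intro L hL hL'
    have hv : IsCTVertex n k x L := by simpa using hL
    refine (hleaf L hv (ct_uncov hT' L hv hL')).2 fun hs => hL' ?_
    exact Finset.mem_union_left _ ((hmem L).2 ⟨hv, hs⟩)
  have hw' : tMatchingWeight w Λ' = ∑ L ∈ Λ', (y L.dropLast + y L) := by
    refine Finset.sum_congr rfl fun L hL => ?_
    exact (hedge L (hT'.1 L hL).1 (hT'.1 L hL).2).2.1 ((hmem L).1 hL).2
  have := hmax Λ' hT'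
  linarith
end
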